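/- Let G be a subcubic block-chain connecting u and v, and let x be a vertex of G. Then G has a finite cactus subgraph F with u, v, x ∈ V(F) such that (1) u and v are d-vertices of F, and (2) for every component H of G − F, the set N_G(V(H)) is contained in the vertex set of a single cycle of F. -/

import Mathlib

namespace IGraph

open SimpleGraph

universe u w

variable {V : Type u} {W : Type w}

/-- `G` is locally finite: every vertex has finite degree. -/
def LocFin (G : SimpleGraph V) : Prop := ∀ v : V, (G.neighborSet v).Finite

/-- A ray of `G`: a one-way infinite path, given by an injective sequence of
successively adjacent vertices. -/
def IsRay (G : SimpleGraph V) (R : ℕ → V) : Prop :=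
  Function.Injective R ∧ ∀ n : ℕ, G.Adj (R n) (R (n + 1))

/-- `G − S`, kept on the same vertex type (removed vertices become isolated). -/
def del (G : SimpleGraph V) (S : Set V) : SimpleGraph V where
  Adj a b := G.Adj a b ∧ a ∉ S ∧ b ∉ S
  symm := ⟨fun a b h => ⟨h.1.symm, h.2.2, h.2.1⟩⟩
  loopless := ⟨fun a h => G.loopless.irrefl a h.1⟩

/-- Two rays are equivalent in `G` if for every finite `S ⊆ V(G)` some component of
`G − S` contains a tail of both. -/
def RayEquiv (G : SimpleGraph V) (R₁ R₂ : ℕ → V) : Prop :=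
  ∀ S : Set V, S.Finite →
    ∃ m n : ℕ, (∀ i, m ≤ i → R₁ i ∉ S) ∧ (∀ j, n ≤ j → R₂ j ∉ S) ∧
      (del G S).Reachable (R₁ m) (R₂ n)

/-- `F` is a faithful subgraph of `G` (both presented on the same vertex type):
(1) every end of `G` contains a ray of `F`, and (2) two rays of `F` are equivalent in `F`
iff they are equivalent in `G`. -/
def Faithful (F G : SimpleGraph V) : Prop :=
  (∀ R : ℕ → V, IsRay G R → ∃ R' : ℕ → V, IsRay F R' ∧ RayEquiv G R R') ∧
  ∀ R₁ R₂ : ℕ → V, IsRay F R₁ → IsRay F R₂ → (RayEquiv F R₁ R₂ ↔ RayEquiv G R₁ R₂)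

/-- `N_G(X)`: vertices outside `X` with a neighbor in `X`. -/
def NSet (G : SimpleGraph V) (X : Set V) : Set V := {y | y ∉ X ∧ ∃ x ∈ X, G.Adj x y}

/-- `Z_G(X)`: vertices of `X` with a neighbor outside `X`. -/
def ZSet (G : SimpleGraph V) (X : Set V) : Set V := {x | x ∈ X ∧ ∃ y, y ∉ X ∧ G.Adj x y}

/-- The vertex set of the component of `G − S` containing `v`. -/
def compOf (G : SimpleGraph V) (S : Set V) (v : V) : Set V := {x | (del G S).Reachable v x}

/-- The degree of the end of `G` represented by the ray `R`: the supremum of the numbers of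
pairwise vertex-disjoint rays equivalent to `R`. -/
noncomputable def endDegree (G : SimpleGraph V) (R : ℕ → V) : ℕ∞ :=
  ⨆ n ∈ {n : ℕ | ∃ f : Fin n → ℕ → V,
      (∀ i, IsRay G (f i) ∧ RayEquiv G (f i) R) ∧
      ∀ i j, i ≠ j → Disjoint (Set.range (f i)) (Set.range (f j))}, (n : ℕ∞)

/-- `H` is `k`-connected: `|V(H)| > k` and removing fewer than `k` vertices leaves a
connected graph. -/
def IsKConn (k : ℕ) (H : SimpleGraph W) : Prop :=
  (k : Cardinal) < Cardinal.mk W ∧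
    ∀ X : Set W, X.Finite → X.ncard < k → (H.induce Xᶜ).Connected

/-- Every vertex has degree at most 3. -/
def Subcubic (G : SimpleGraph V) : Prop :=
  ∀ v : V, (G.neighborSet v).Finite ∧ (G.neighborSet v).ncard ≤ 3

/-- Every vertex has degree exactly 3. -/
def Cubic (G : SimpleGraph V) : Prop := ∀ v : V, (G.neighborSet v).ncard = 3

/-- `S` is 3-connected in `G`: every two vertices of `S` are joined by three pairwise
internally disjoint paths of `G`. -/
def ThreeConnIn (G : SimpleGraph V) (S : Set V) : Prop :=
  ∀ u v : V, u ∈ S → v ∈ S → u ≠ v →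
    ∃ p₁ p₂ p₃ : G.Path u v,
      p₁ ≠ p₂ ∧ p₁ ≠ p₃ ∧ p₂ ≠ p₃ ∧
      (∀ x, x ∈ (p₁ : G.Walk u v).support → x ∈ (p₂ : G.Walk u v).support → x = u ∨ x = v) ∧
      (∀ x, x ∈ (p₁ : G.Walk u v).support → x ∈ (p₃ : G.Walk u v).support → x = u ∨ x = v) ∧
      (∀ x, x ∈ (p₂ : G.Walk u v).support → x ∈ (p₃ : G.Walk u v).support → x = u ∨ x = v)

/-- A subgraph which is a (finite) cycle: finite, nonempty, connected and 2-regular. -/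
def IsCycleSub {G : SimpleGraph W} (C : G.Subgraph) : Prop :=
  C.verts.Finite ∧ C.verts.Nonempty ∧ C.Connected ∧
    ∀ v ∈ C.verts, (C.neighborSet v).ncard = 2

/-- A cactus: a connected subcubic graph whose cycles are pairwise vertex-disjoint and whose
edges decompose into vertex-disjoint cycles and vertex-disjoint paths (equivalently, every
vertex on no cycle has degree at most 2). -/
def IsCactus (H : SimpleGraph W) : Prop :=
  H.Connected ∧ Subcubic H ∧
  (∀ C₁ C₂ : H.Subgraph, IsCycleSub C₁ → IsCycleSub C₂ → C₁ ≠ C₂ →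
    Disjoint C₁.verts C₂.verts) ∧
  ∀ v : W, (∀ C : H.Subgraph, IsCycleSub C → v ∉ C.verts) → (H.neighborSet v).ncard ≤ 2

/-- A semi-cactus: connected, maximum degree at most 4, every block is a cycle or a `K₂`
(equivalently, distinct cycles are edge-disjoint), and every vertex lies in at most two
blocks (cycles through `v` together with bridges at `v` number at most 2). -/
def IsSemiCactus (H : SimpleGraph W) : Prop :=
  H.Connected ∧ (∀ v : W, (H.neighborSet v).Finite ∧ (H.neighborSet v).ncard ≤ 4) ∧
  (∀ C₁ C₂ : H.Subgraph, IsCycleSub C₁ → IsCycleSub C₂ → C₁ ≠ C₂ →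
    Disjoint C₁.edgeSet C₂.edgeSet) ∧
  ∀ v : W,
    {C : H.Subgraph | IsCycleSub C ∧ v ∈ C.verts}.encard +
      {e : Sym2 W | e ∈ H.edgeSet ∧ v ∈ e ∧
        ∀ C : H.Subgraph, IsCycleSub C → e ∉ C.edgeSet}.encard ≤ 2

/-- Every cycle of `H` is even. -/
def EvenCycles (H : SimpleGraph W) : Prop :=
  ∀ C : H.Subgraph, IsCycleSub C → Even C.verts.ncard

/-- `v` is a cut-vertex of `H`: removing `v` separates two vertices. -/
def IsCutVert (H : SimpleGraph W) (v : W) : Prop :=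
  ∃ a b : W, a ≠ v ∧ b ≠ v ∧ H.Reachable a b ∧ ¬ (del H {v}).Reachable a b

/-- `H` is non-separable: connected without cut-vertices. -/
def Nonseparable (H : SimpleGraph W) : Prop := H.Connected ∧ ∀ v : W, ¬ IsCutVert H v

/-- `B` is the vertex set of a block of `H`: a maximal set inducing a non-separable graph. -/
def IsBlockSet (H : SimpleGraph W) (B : Set W) : Prop :=
  Nonseparable (H.induce B) ∧ ∀ B' : Set W, B ⊆ B' → Nonseparable (H.induce B') → B' = B

/-- An end-block: a block containing at most one cut-vertex of `H`. -/
def IsEndBlock (H : SimpleGraph W) (B : Set W) : Prop :=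
  IsBlockSet H B ∧ {v ∈ B | IsCutVert H v}.encard ≤ 1

/-- A block-chain: a connected graph whose block-cut tree is a path, i.e. every block
contains at most two cut-vertices and every cut-vertex lies in at most two blocks. -/
def IsBlockChain (H : SimpleGraph W) : Prop :=
  H.Connected ∧
  (∀ B : Set W, IsBlockSet H B → {v ∈ B | IsCutVert H v}.encard ≤ 2) ∧
  ∀ v : W, IsCutVert H v → {B : Set W | IsBlockSet H B ∧ v ∈ B}.encard ≤ 2

/-- A block-chain connecting `u` and `v`: either `H` is non-separable, or `H` is separable
and `u`, `v` are non-cut vertices of two distinct end-blocks. -/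
def BlockChainConn (H : SimpleGraph W) (u v : W) : Prop :=
  IsBlockChain H ∧
  (Nonseparable H ∨
    ((∃ x, IsCutVert H x) ∧
      ∃ B₁ B₂ : Set W, IsEndBlock H B₁ ∧ IsEndBlock H B₂ ∧ B₁ ≠ B₂ ∧
        u ∈ B₁ ∧ v ∈ B₂ ∧ ¬ IsCutVert H u ∧ ¬ IsCutVert H v))

/-- The `k`-th power of `G`: vertices at distance at most `k` become adjacent. -/
def gpow (G : SimpleGraph V) (k : ℕ) : SimpleGraph V where
  Adj u v := u ≠ v ∧ ∃ p : G.Walk u v, p.length ≤ k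
  symm := ⟨fun u v h => ⟨h.1.symm, by obtain ⟨p, hp⟩ := h.2; exact ⟨p.reverse, by simpa using hp⟩⟩⟩
  loopless := ⟨fun v h => h.1 rfl⟩

/-- The copy `G × {d₀}` of `G` inside the Cartesian product `G □ D`. -/
def copyAt (G : SimpleGraph V) (d₀ : W) : SimpleGraph (V × W) where
  Adj p q := G.Adj p.1 q.1 ∧ p.2 = d₀ ∧ q.2 = d₀
  symm := ⟨fun p q h => ⟨h.1.symm, h.2.2, h.2.1⟩⟩
  loopless := ⟨fun p h => G.loopless.irrefl _ h.1⟩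

/-- The line graph of the subgraph `F` of `G`, presented on the vertex set `E(G)` of the
line graph of `G` (edges of `G` not in `F` are isolated). -/
def lineSub (G F : SimpleGraph V) : SimpleGraph G.edgeSet where
  Adj e f := (e : Sym2 V) ∈ F.edgeSet ∧ (f : Sym2 V) ∈ F.edgeSet ∧ e ≠ f ∧
    ∃ x : V, x ∈ (e : Sym2 V) ∧ x ∈ (f : Sym2 V)
  symm := ⟨fun e f h =>
    ⟨h.2.1, h.1, h.2.2.1.symm, by obtain ⟨x, h1, h2⟩ := h.2.2.2; exact ⟨x, h2, h1⟩⟩⟩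
  loopless := ⟨fun e h => h.2.2.1 rfl⟩

/-- `B ⊆ V(G)` induces a cycle of `G`. -/
def IsCycleSet (G : SimpleGraph V) (B : Set V) : Prop :=
  B.Finite ∧ B.Nonempty ∧ (G.induce B).Connected ∧
    ∀ v ∈ B, (G.neighborSet v ∩ B).ncard = 2

/-- Some walk of `G` from `a` to `b` stays in `S`. -/
def Joined (G : SimpleGraph V) (S : Set V) (a b : V) : Prop :=
  ∃ p : G.Walk a b, ∀ y ∈ p.support, y ∈ S

namespace Joined

variable {G : SimpleGraph V} {S T : Set V} {a b c : V}

lemma refl (ha : a ∈ S) : Joined G S a a := ⟨.nil, by simpa⟩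

lemma symm (h : Joined G S a b) : Joined G S b a := by
  obtain ⟨p, hp⟩ := h
  exact ⟨p.reverse, by simpa using hp⟩

lemma trans (h : Joined G S a b) (h' : Joined G S b c) : Joined G S a c := by
  obtain ⟨p, hp⟩ := h
  obtain ⟨q, hq⟩ := h'
  refine ⟨p.append q, fun y hy => ?_⟩
  rcases Walk.mem_support_append_iff _ _ |>.1 hy with h | h
  exacts [hp y h, hq y h]

lemma mono (h : Joined G S a b) (hST : S ⊆ T) : Joined G T a b := by
  obtain ⟨p, hp⟩ := h
  exact ⟨p, fun y hy => hST (hp y hy)⟩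

lemma left_mem (h : Joined G S a b) : a ∈ S := by
  obtain ⟨p, hp⟩ := h
  exact hp _ p.start_mem_support

lemma right_mem (h : Joined G S a b) : b ∈ S := h.symm.left_mem

lemma of_adj (h : G.Adj a b) (ha : a ∈ S) (hb : b ∈ S) : Joined G S a b :=
  ⟨.cons h .nil, by simp [ha, hb]⟩

lemma exists_isPath (h : Joined G S a b) :
    ∃ p : G.Walk a b, p.IsPath ∧ ∀ y ∈ p.support, y ∈ S := by
  classical
  obtain ⟨p, hp⟩ := h
  exact ⟨p.bypass, p.bypass_isPath, fun y hy => hp y (p.support_bypass_subset_support hy)⟩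

end Joined

lemma joined_of_mem_support {G : SimpleGraph V} {S : Set V} {a b c d : V} {p : G.Walk a b}
    (hp : ∀ y ∈ p.support, y ∈ S) (hc : c ∈ p.support) (hd : d ∈ p.support) :
    Joined G S c d := by
  classical
  have key : ∀ e ∈ p.support, Joined G S a e := fun e he =>
    ⟨p.takeUntil e he, fun y hy => hp y (p.support_takeUntil_subset_support he hy)⟩
  exact (key c hc).symm.trans (key d hd)

/-- The initial part of a walk up to the first time it enters `T`. -/
lemma exists_first_entry {G : SimpleGraph V} {T : Set V} {a b : V} (p : G.Walk a b)
    (ha : a ∉ T) (hT : ∃ t ∈ p.support, t ∈ T) :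
    ∃ (k z : V) (r : G.Walk a k), G.Adj k z ∧ z ∈ T ∧ z ∈ p.support ∧
      (∀ y ∈ r.support, y ∈ p.support ∧ y ∉ T) ∧ r.length < p.length := by
  induction p with
  | nil =>
    obtain ⟨t, ht, htT⟩ := hT
    simp only [Walk.support_nil, List.mem_singleton] at ht
    exact absurd (ht ▸ htT) ha
  | @cons a c b h p ih =>
    by_cases hc : c ∈ T
    · exact ⟨a, c, .nil, h, hc, by simp, by simp [ha], by simp⟩
    · obtain ⟨t, ht, htT⟩ := hT
      have ht' : t ∈ p.support := by
        rcases List.mem_cons.1 (Walk.support_cons h p ▸ ht) with rfl | h'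
        exacts [absurd htT ha, h']
      obtain ⟨k, z, r, hkz, hz, hzp, hr, hl⟩ := ih hc ⟨t, ht', htT⟩
      refine ⟨k, z, .cons h r, hkz, hz, by simp [hzp], ?_, by simpa⟩
      intro y hy
      rcases List.mem_cons.1 (Walk.support_cons h r ▸ hy) with rfl | h'
      · exact ⟨by simp, ha⟩
      · exact ⟨by simp [(hr y h').1], (hr y h').2⟩

/-- A walk in `S` either enters `T`, or stays in `S \ T`. -/
lemma Joined.exists_first_entry {G : SimpleGraph V} {S T : Set V} {a b : V}
    (h : Joined G S a b) (ha : a ∉ T) (hb : b ∈ T) :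
    ∃ k z, Joined G (S \ T) a k ∧ G.Adj k z ∧ z ∈ T ∧ z ∈ S := by
  obtain ⟨p, hp⟩ := h
  obtain ⟨k, z, r, hkz, hz, hzp, hr, -⟩ :=
    IGraph.exists_first_entry p ha ⟨b, p.end_mem_support, hb⟩
  exact ⟨k, z, ⟨r, fun y hy => ⟨hp y (hr y hy).1, (hr y hy).2⟩⟩, hkz, hz, hp z hzp⟩

/-- Every vertex of `S` is joined in `S` to `u`, and after removing any other vertex it is still
joined to `u` or `v`; that is, adding the edge `uv` to `G[S]` leaves no cut-vertex. -/
structure Linked (G : SimpleGraph V) (S : Set V) (u v : V) : Prop where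
  left_mem : u ∈ S
  right_mem : v ∈ S
  joined : ∀ w ∈ S, Joined G S w u
  avoid : ∀ c ∈ S, ∀ w ∈ S, w ≠ c → Joined G (S \ {c}) w u ∨ Joined G (S \ {c}) w v

namespace Linked

variable {G : SimpleGraph V} {S X : Set V} {u v a b : V}

lemma symm (h : Linked G S u v) : Linked G S v u where
  left_mem := h.right_mem
  right_mem := h.left_mem
  joined w hw := (h.joined w hw).trans (h.joined v h.right_mem).symm
  avoid c hc w hw hwc := (h.avoid c hc w hw hwc).symm

lemma eq_singleton (h : Linked G S u u) : S = {u} := by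
  refine Set.eq_singleton_iff_unique_mem.2 ⟨h.left_mem, fun w hw => ?_⟩
  by_contra hne
  rcases h.avoid u h.left_mem w hw hne with h | h <;> exact h.right_mem.2 rfl

/-- A walk in `S` starting in `X` reaches `a` or `b` inside `X` when all ways out of `X` start
at `a` or `b`. -/
lemma exists_walk_of_exits
    (hexit : ∀ k ∈ X, ∀ y ∈ S, y ∉ X → G.Adj k y → k = a ∨ k = b) {T : Set V} (hT : T ⊆ S)
    {w t : V} (hw : w ∈ X) (ht : t ∈ X → t = a ∨ t = b) (p : G.Walk w t)
    (hp : ∀ y ∈ p.support, y ∈ T) :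
    ∃ (d : V) (r : G.Walk w d), (d = a ∨ d = b) ∧ (∀ y ∈ r.support, y ∈ X ∧ y ∈ T) ∧
      r.length ≤ p.length ∧ (t ∉ X → r.length < p.length) := by
  by_cases hst : ∃ y ∈ p.support, y ∈ Xᶜ
  · obtain ⟨k, z, r, hkz, hz, hzp, hr, hl⟩ := IGraph.exists_first_entry p (by simpa using hw) hst
    have hr' : ∀ y ∈ r.support, y ∈ X ∧ y ∈ T := fun y hy =>
      ⟨by simpa using (hr y hy).2, hp y (hr y hy).1⟩
    exact ⟨k, r, hexit k (hr' k r.end_mem_support).1 z (hT (hp z hzp)) hz hkz, hr', hl.le,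
      fun _ => hl⟩
  · push Not at hst
    have htX : t ∈ X := by simpa using hst t p.end_mem_support
    exact ⟨t, p, ht htX, fun y hy => ⟨by simpa using hst y hy, hp y hy⟩, le_rfl,
      fun h => absurd htX h⟩

lemma of_exits (h : Linked G S u v) (hX : X ⊆ S) (haX : a ∈ X) (hbX : b ∈ X)
    (hab : Joined G X a b) (hexit : ∀ k ∈ X, ∀ y ∈ S, y ∉ X → G.Adj k y → k = a ∨ k = b)
    (hu : u ∈ X → u = a ∨ u = b) (hv : v ∈ X → v = a ∨ v = b) : Linked G X a b := by
  refine ⟨haX, hbX, fun w hw => ?_, fun c hc w hw hwc => ?_⟩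
  · obtain ⟨p, hp⟩ := h.joined w (hX hw)
    obtain ⟨d, r, hd, hr, -⟩ := exists_walk_of_exits hexit subset_rfl hw hu p hp
    have hr : Joined G X w d := ⟨r, fun y hy => (hr y hy).1⟩
    rcases hd with rfl | rfl
    exacts [hr, hr.trans hab.symm]
  · have key : ∀ t, (t ∈ X → t = a ∨ t = b) → Joined G (S \ {c}) w t →
        Joined G (X \ {c}) w a ∨ Joined G (X \ {c}) w b := by
      rintro t ht ⟨p, hp⟩
      obtain ⟨d, r, hd, hr, -⟩ := exists_walk_of_exits hexit Set.sdiff_subset hw ht p hp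
      have hr : Joined G (X \ {c}) w d := ⟨r, fun y hy => ⟨(hr y hy).1, (hr y hy).2.2⟩⟩
      rcases hd with rfl | rfl
      exacts [.inl hr, .inr hr]
    rcases h.avoid c (hX hc) w (hX hw) hwc with h | h
    exacts [key u hu h, key v hv h]

end Linked

lemma isPath_append_iff {G : SimpleGraph V} {a b c : V} {p : G.Walk a b} {q : G.Walk b c} :
    (p.append q).IsPath ↔
      p.IsPath ∧ q.IsPath ∧ ∀ y ∈ p.support, y ∈ q.support → y = b := by
  have hq : q.support = b :: q.support.tail := (q.cons_tail_support).symm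
  constructor
  · intro h
    refine ⟨h.of_append_left, h.of_append_right, fun y hy hy' => ?_⟩
    rw [Walk.isPath_def, Walk.support_append, List.nodup_append'] at h
    rw [hq] at hy'
    rcases List.mem_cons.1 hy' with h' | h'
    exacts [h', absurd h' (h.2.2 hy)]
  · rintro ⟨h₁, h₂, h₃⟩
    rw [Walk.isPath_def, Walk.support_append, List.nodup_append']
    rw [Walk.isPath_def] at h₁ h₂
    refine ⟨h₁, h₂.tail, fun y hy hy' => ?_⟩
    have := h₃ y hy (List.mem_of_mem_tail hy')
    rw [hq, List.nodup_cons] at h₂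
    exact h₂.1 (this ▸ hy')

/-- `P` and `Q` are distinct internally disjoint `u`-`v` paths of `G[S]`, forming a cycle. -/
structure PathPair (G : SimpleGraph V) (S : Set V) {u v : V} (P Q : G.Walk u v) : Prop where
  isPath_left : P.IsPath
  isPath_right : Q.IsPath
  left_mem : ∀ y ∈ P.support, y ∈ S
  right_mem : ∀ y ∈ Q.support, y ∈ S
  ne : P ≠ Q
  disj : ∀ y ∈ P.support, y ∈ Q.support → y = u ∨ y = v

namespace PathPair

variable {G : SimpleGraph V} {S : Set V} {u v : V} {P Q : G.Walk u v}

lemma symm (h : PathPair G S P Q) : PathPair G S Q P :=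
  ⟨h.isPath_right, h.isPath_left, h.right_mem, h.left_mem, h.ne.symm, fun y hP hQ => h.disj y hQ hP⟩

lemma isCycle (h : PathPair G S P Q) : (P.append Q.reverse).IsCycle := by
  refine h.isPath_left.isCycle_append (Walk.isPath_reverse_iff Q |>.2 h.isPath_right)
    (fun y hy hy' => ?_) ?_
  · have h₁ := h.isPath_left.support_nodup
    have h₂ := (Walk.isPath_reverse_iff Q |>.2 h.isPath_right).support_nodup
    rw [← P.cons_tail_support, List.nodup_cons] at h₁
    rw [← Q.reverse.cons_tail_support, List.nodup_cons] at h₂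
    have hQ : y ∈ Q.support := by simpa using List.mem_of_mem_tail hy'
    rcases h.disj y (List.mem_of_mem_tail hy) hQ with rfl | rfl
    exacts [h₁.1 hy, h₂.1 hy']
  · by_contra! hl
    have hQ : Q.length ≤ 1 := by simpa using hl.2
    exact h.ne (Walk.eq_of_length_le_one hl.1 hQ)

/-- The cycle formed by the two paths. -/
def cycle (P Q : G.Walk u v) : G.Subgraph := P.toSubgraph ⊔ Q.toSubgraph

lemma mem_cycle {y : V} : y ∈ (cycle P Q).verts ↔ y ∈ P.support ∨ y ∈ Q.support := by
  simp [cycle]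

lemma isCycleSub (h : PathPair G S P Q) : IsCycleSub (cycle P Q) := by
  have e : cycle P Q = (P.append Q.reverse).toSubgraph := by
    simp [cycle, Walk.toSubgraph_append, Walk.toSubgraph_reverse]
  rw [e]
  refine ⟨?_, ⟨u, by simp⟩, Walk.toSubgraph_connected _, fun y hy => ?_⟩
  · rw [Walk.verts_toSubgraph]
    exact List.finite_toSet _
  · exact h.isCycle.ncard_neighborSet_toSubgraph_eq_two (by simpa using hy)

end PathPair

lemma isPath_detour {G : SimpleGraph V} {u v y z k l : V} {A : G.Walk u y}
    {M : G.Walk y z} {B : G.Walk z v} {Q : G.Walk k l} (hP : (A.append (M.append B)).IsPath)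
    (hyz : y ≠ z) (hQ : Q.IsPath)
    (hd : ∀ t ∈ Q.support, t ∉ (A.append (M.append B)).support)
    (hyk : G.Adj y k) (hlz : G.Adj l z) :
    (A.append (.cons hyk (Q.append (.cons hlz B)))).IsPath := by
  simp only [Walk.mem_support_append_iff, not_or] at hd
  simp only [isPath_append_iff, Walk.cons_isPath_iff, Walk.mem_support_append_iff,
    Walk.support_cons, List.mem_cons, not_or] at hP ⊢
  obtain ⟨hA, ⟨hM, hB, hMB⟩, hAMB⟩ := hP
  have hyB : y ∉ B.support := fun h => hyz (hMB y M.start_mem_support h)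
  have hyA : y ∈ A.support := A.end_mem_support
  refine ⟨hA, ⟨⟨hQ, ⟨hB, fun h => (hd l Q.end_mem_support).2.2 h⟩, ?_⟩, ?_⟩, ?_⟩
  · rintro t ht (rfl | ht')
    exacts [rfl, absurd ht' (hd t ht).2.2]
  · refine ⟨fun h => (hd y h).1 hyA, ?_, hyB⟩
    rintro rfl
    exact (hd y Q.end_mem_support).1 hyA
  · rintro t ht (rfl | h | rfl | h)
    · rfl
    · exact absurd ht (hd t h).1
    · exact absurd ht (hd _ Q.end_mem_support).1
    · exact hAMB t ht (.inr h)

/-- A path can be rerouted through an ear attached to it at two distinct vertices. -/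
lemma exists_path_through_ear {G : SimpleGraph V} {u v y z k l : V} {P : G.Walk u v}
    (hP : P.IsPath) (hy : y ∈ P.support) (hz : z ∈ P.support) (hyz : y ≠ z)
    {Q : G.Walk k l} (hd : ∀ t ∈ Q.support, t ∉ P.support)
    (hyk : G.Adj y k) (hlz : G.Adj l z) :
    ∃ P' : G.Walk u v, P'.IsPath ∧ k ∈ P'.support ∧
      ∀ t ∈ P'.support, t ∈ P.support ∨ t ∈ Q.support := by
  classical
  wlog hQ : Q.IsPath generalizing Q
  · obtain ⟨P', h₁, h₂, h₃⟩ := this (Q := Q.bypass)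
      (fun t ht => hd t (Q.support_bypass_subset_support ht)) Q.bypass_isPath
    exact ⟨P', h₁, h₂, fun t ht => (h₃ t ht).imp_right (Q.support_bypass_subset_support ·)⟩
  obtain ⟨A, B, rfl⟩ := P.mem_support_iff_exists_append.1 hy
  rcases (Walk.mem_support_append_iff _ _).1 hz with h | h
  · obtain ⟨A, M, rfl⟩ := A.mem_support_iff_exists_append.1 h
    rw [← Walk.append_assoc] at hP hd
    refine ⟨_, isPath_detour hP hyz.symm hQ.reverse (by simpa using hd) hlz.symm hyk.symm,
      by simp, fun t ht => ?_⟩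
    simp only [Walk.mem_support_append_iff, Walk.support_cons, List.mem_cons,
      Walk.support_reverse, List.mem_reverse] at ht ⊢
    rcases ht with h | rfl | h | rfl | h <;> simp_all
  · obtain ⟨M, B, rfl⟩ := B.mem_support_iff_exists_append.1 h
    refine ⟨_, isPath_detour hP hyz hQ hd hyk hlz, by simp, fun t ht => ?_⟩
    simp only [Walk.mem_support_append_iff, Walk.support_cons, List.mem_cons] at ht ⊢
    rcases ht with h | rfl | h | rfl | h <;> simp_all

/-- No vertex of `S` separates `G[S]`. -/
def NoCut (G : SimpleGraph V) (S : Set V) : Prop :=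
  ∀ c, ∀ w ∈ S, ∀ w' ∈ S, w ≠ c → w' ≠ c → Joined G (S \ {c}) w w'

lemma PathPair.extend {G : SimpleGraph V} {S : Set V} {u k v z : V} {P Q : G.Walk u k}
    (h : PathPair G S P Q) (hvS : v ∈ S) (hkv : G.Adj k v) (hvQ : v ∉ Q.support)
    (hz : z ∈ P.support) (hzk : z ≠ k) {R : G.Walk z v} (hR : R.IsPath)
    (hRS : ∀ y ∈ R.support, y ∈ S)
    (hRd : ∀ y ∈ R.support, y ∈ P.support ∨ y ∈ Q.support → y = z) :
    ∃ P' Q' : G.Walk u v, PathPair G S P' Q' := by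
  obtain ⟨A, B, rfl⟩ := P.mem_support_iff_exists_append.1 hz
  obtain ⟨hA, hB, hAB⟩ := isPath_append_iff.1 h.isPath_left
  have hkA : k ∉ A.support := fun hk => hzk (hAB k hk B.end_mem_support).symm
  have hkR : k ∉ R.support := fun hk => hzk (hRd k hk (.inr Q.end_mem_support)).symm
  refine ⟨A.append R, Q.concat hkv, isPath_append_iff.2 ⟨hA, hR, fun y hy hy' => ?_⟩,
    h.isPath_right.concat hvQ hkv, fun y hy => ?_, fun y hy => ?_, fun e => ?_, fun y hy hy' => ?_⟩
  · exact hRd y hy' (.inl (by simp [hy]))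
  · rcases (Walk.mem_support_append_iff _ _).1 hy with h' | h'
    exacts [h.left_mem y (by simp [h']), hRS y h']
  · simp only [Walk.support_concat, List.mem_append,
      List.mem_singleton] at hy
    rcases hy with hy | rfl
    exacts [h.right_mem y hy, hvS]
  · have : k ∈ (A.append R).support := by simp [e, Walk.support_concat]
    rcases (Walk.mem_support_append_iff _ _).1 this with h' | h'
    exacts [hkA h', hkR h']
  · simp only [Walk.support_concat, List.mem_append,
      List.mem_singleton] at hy'
    rcases hy' with hy' | rfl
    · have hyA : y ∈ A.support := by
        rcases (Walk.mem_support_append_iff _ _).1 hy with h' | h'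
        exacts [h', hRd y h' (.inr hy') ▸ A.end_mem_support]
      rcases h.disj y (by simp [hyA]) hy' with rfl | rfl
      exacts [.inl rfl, absurd hyA hkA]
    · exact .inr rfl

/-- In a graph without cut-vertices any two vertices are joined by two internally disjoint
paths, unless one of them is a leaf. -/
lemma exists_pathPair {G : SimpleGraph V} {S : Set V} (hS : NoCut G S) {u a b : V} (huS : u ∈ S)
    (ha : a ∈ S) (hb : b ∈ S) (hab : a ≠ b) (hua : G.Adj u a) (hub : G.Adj u b) {v : V}
    (hvu : v ≠ u) (p : G.Walk v u) (hp : ∀ y ∈ p.support, y ∈ S) :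
    ∃ P Q : G.Walk u v, PathPair G S P Q := by
  induction p with
  | nil => exact absurd rfl hvu
  | @cons v k u hvk p ih =>
    have hvS : v ∈ S := hp v (by simp)
    by_cases hku : k = u
    · subst hku
      obtain ⟨b, hb, hvb, hub⟩ : ∃ b ∈ S, b ≠ v ∧ G.Adj k b := by
        by_cases h : a = v
        exacts [⟨b, hb, fun h' => hab (h.trans h'.symm), hub⟩, ⟨a, ha, h, hua⟩]
      obtain ⟨R, hR, hRS⟩ := (hS k b hb v hvS hub.ne' hvu).exists_isPath
      refine ⟨.cons hub R, .cons hvk.symm .nil, (Walk.cons_isPath_iff _ _).2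
        ⟨hR, fun h => (hRS k h).2 rfl⟩, ?_, ?_, ?_, ?_, ?_⟩
      · simp [hvk.ne']
      · simp only [Walk.support_cons, List.mem_cons]
        rintro y (rfl | hy)
        exacts [huS, (hRS y hy).1]
      · simp [huS, hvS]
      · rintro e
        have : b ∈ (Walk.cons hvk.symm .nil : G.Walk k v).support := by simp [← e]
        simp [hub.ne', hvb] at this
      · simp
    · obtain ⟨P, Q, h⟩ := ih huS hua hub hku fun y hy => hp y (by simp [hy])
      have hkS : k ∈ S := hp k (by simp)
      obtain ⟨z, R, hzk, hzT, hR, hRS, hRd⟩ : ∃ (z : V) (R : G.Walk z v), z ≠ k ∧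
          (z ∈ P.support ∨ z ∈ Q.support) ∧ R.IsPath ∧ (∀ y ∈ R.support, y ∈ S) ∧
          ∀ y ∈ R.support, y ∈ P.support ∨ y ∈ Q.support → y = z := by
        by_cases hvT : v ∈ P.support ∨ v ∈ Q.support
        · exact ⟨v, .nil, hvk.ne, hvT, by simp, by simp [hvS], by simp⟩
        · obtain ⟨l, z, hl, hlz, hzT, hzS⟩ := (hS k v hvS u huS hvk.ne
            (Ne.symm hku)).exists_first_entry (T := {y | y ∈ P.support ∨ y ∈ Q.support}) hvT
            (.inl P.start_mem_support)
          obtain ⟨R, hR, hRS⟩ := hl.symm.exists_isPath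
          refine ⟨z, .cons hlz.symm R, hzS.2, hzT,
            (Walk.cons_isPath_iff _ _).2 ⟨hR, fun h => (hRS z h).2 hzT⟩, ?_, ?_⟩
          · simp only [Walk.support_cons, List.mem_cons]
            rintro y (rfl | hy)
            exacts [hzS.1, (hRS y hy).1.1]
          · simp only [Walk.support_cons, List.mem_cons]
            rintro y (rfl | hy) hyT
            exacts [rfl, absurd hyT (hRS y hy).2]
      have hvPQ : ∀ {y}, y ∈ P.support → y ∈ Q.support → y ≠ v := by
        rintro y hy hy' rfl
        rcases h.disj y hy hy' with rfl | rfl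
        exacts [hvu rfl, hvk.ne rfl]
      rcases hzT with hz | hz
      · refine h.extend hvS hvk.symm (fun hvQ => ?_) hz hzk hR hRS hRd
        have := hRd v R.end_mem_support (.inr hvQ)
        exact hvPQ (this ▸ hz) hvQ rfl
      · refine h.symm.extend hvS hvk.symm (fun hvP => ?_) hz hzk hR hRS
          fun y hy hyT => hRd y hy hyT.symm
        have := hRd v R.end_mem_support (.inl hvP)
        exact hvPQ hvP (this ▸ hz) rfl

/-- A pair of paths can be rerouted through an ear attached to the first path. -/
lemma PathPair.exists_reroute {G : SimpleGraph V} {S : Set V} {u v y z k l : V} {P Q : G.Walk u v}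
    (h : PathPair G S P Q) (hy : y ∈ P.support) (hz : z ∈ P.support) (hyz : y ≠ z)
    (hyk : G.Adj y k) (hlz : G.Adj l z) (hkl : Joined G (S \ (PathPair.cycle P Q).verts) k l) :
    ∃ P' : G.Walk u v, PathPair G S P' Q ∧ k ∈ P'.support := by
  obtain ⟨R, hR⟩ := hkl
  simp only [Set.mem_sdiff, PathPair.mem_cycle, not_or] at hR
  obtain ⟨P', hP', hk, hsub⟩ := exists_path_through_ear h.isPath_left hy hz hyz
    (fun t ht => (hR t ht).2.1) hyk hlz
  refine ⟨P', ⟨hP', h.isPath_right, fun t ht => ?_, h.right_mem, ?_, fun t ht htQ => ?_⟩, hk⟩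
  · rcases hsub t ht with h' | h'
    exacts [h.left_mem t h', (hR t h').1]
  · rintro rfl
    exact (hR k R.start_mem_support).2.2 hk
  · rcases hsub t ht with h' | h'
    exacts [h.disj t h' htQ, absurd htQ (hR t h').2.2]

/-- A vertex of a cycle of a subcubic graph has at most one neighbor off the cycle. -/
lemma IsCycleSub.eq_of_adj {G : SimpleGraph V} (hsc : Subcubic G) {C : G.Subgraph}
    (hC : IsCycleSub C) {y k l : V} (hy : y ∈ C.verts) (hk : k ∉ C.verts) (hl : l ∉ C.verts)
    (hky : G.Adj k y) (hly : G.Adj l y) : k = l := by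
  by_contra hkl
  have hfin := (hsc y).1
  have hd : Disjoint (C.neighborSet y) {k, l} := by
    rw [Set.disjoint_right]
    rintro t (rfl | rfl) ht
    exacts [hk (C.edge_vert (Subgraph.Adj.symm ht)), hl (C.edge_vert (Subgraph.Adj.symm ht))]
  have hsub : C.neighborSet y ∪ {k, l} ⊆ G.neighborSet y := by
    rintro t (ht | rfl | rfl)
    exacts [C.adj_sub ht, hky.symm, hly.symm]
  have h₁ := Set.ncard_le_ncard hsub hfin
  rw [Set.ncard_union_eq hd (hfin.subset (C.neighborSet_subset y)), hC.2.2.2 y hy,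
    Set.ncard_pair hkl] at h₁
  have := (hsc y).2
  omega

/-- If `G[S]` has no cut-vertex and contains a cycle through `u` and `v`, then such a cycle can be
chosen to contain `x`, or so that the component of `x` off the cycle is attached to it by exactly
two edges, one to the interior of each of its two `u`-`v` paths. -/
lemma exists_pathPair_two_exits {G : SimpleGraph V} (hsc : Subcubic G) {S : Set V}
    (hS : NoCut G S) {u v x : V} (hx : x ∈ S) (huv : u ≠ v) {P₀ Q₀ : G.Walk u v}
    (h₀ : PathPair G S P₀ Q₀) (hconn : Joined G S u x) :
    ∃ P Q : G.Walk u v, PathPair G S P Q ∧ (x ∈ (PathPair.cycle P Q).verts ∨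
      (x ∉ (PathPair.cycle P Q).verts ∧ ∃ k y l z, y ∈ P.support ∧ y ∉ Q.support ∧
        z ∈ Q.support ∧ z ∉ P.support ∧ G.Adj k y ∧ G.Adj l z ∧
        Joined G (S \ (PathPair.cycle P Q).verts) x k ∧
        Joined G (S \ (PathPair.cycle P Q).verts) x l ∧
        ∀ k', Joined G (S \ (PathPair.cycle P Q).verts) x k' →
          ∀ y' ∈ (PathPair.cycle P Q).verts, G.Adj k' y' → k' = k ∨ k' = l)) := by
  classical
  by_cases hcyc : ∃ P Q : G.Walk u v, PathPair G S P Q ∧ x ∈ (PathPair.cycle P Q).verts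
  · obtain ⟨P, Q, h, hxC⟩ := hcyc
    exact ⟨P, Q, h, .inl hxC⟩
  push Not at hcyc
  -- choose the cycle first to be as close to `x` as possible
  have hA : ∃ n, ∃ P Q : G.Walk u v, PathPair G S P Q ∧ ∃ y ∈ P.support, ∃ p : G.Walk y x,
      (∀ t ∈ p.support, t ∈ S) ∧ p.length = n := by
    obtain ⟨p, hp⟩ := hconn
    exact ⟨_, P₀, Q₀, h₀, u, by simp, p, hp, rfl⟩
  have hmin : ∀ P Q : G.Walk u v, PathPair G S P Q → ∀ y ∈ P.support, ∀ p : G.Walk y x,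
      (∀ t ∈ p.support, t ∈ S) → Nat.find hA ≤ p.length := fun P Q h y hy p hp =>
    Nat.find_min' hA ⟨P, Q, h, y, hy, p, hp, rfl⟩
  -- a nearest vertex `y` of the cycle is the only attachment on its path
  have nearest : ∀ P Q : G.Walk u v, PathPair G S P Q → ∀ y ∈ P.support, ∀ p : G.Walk y x,
      (∀ t ∈ p.support, t ∈ S) → p.length = Nat.find hA →
      ∃ k, G.Adj k y ∧ Joined G (S \ (PathPair.cycle P Q).verts) x k ∧
        ∀ l, Joined G (S \ (PathPair.cycle P Q).verts) x l → ∀ z ∈ P.support, G.Adj l z →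
          z = y := by
    intro P Q h y hy p hp hl
    have hxC := hcyc P Q h
    cases p with
    | nil => exact absurd (PathPair.mem_cycle.2 (.inl hy)) hxC
    | @cons _ k _ e p =>
      have hpS : ∀ t ∈ p.support, t ∈ S := fun t ht => hp t (by simp [ht])
      simp only [Walk.length_cons] at hl
      have hpC : ∀ t ∈ p.support, t ∈ S \ (PathPair.cycle P Q).verts := by
        refine fun t ht => ⟨hpS t ht, fun htC => ?_⟩
        have hdrop : ∀ t' ∈ (p.dropUntil t ht).support, t' ∈ S := fun t' ht' =>
          hpS t' (p.support_dropUntil_subset_support ht ht')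
        have hlen := p.length_dropUntil_le_length ht
        rcases PathPair.mem_cycle.1 htC with h' | h'
        · have := hmin P Q h t h' _ hdrop
          omega
        · have := hmin Q P h.symm t h' _ hdrop
          omega
      refine ⟨k, e.symm, Joined.symm ⟨p, hpC⟩, fun l hxl z hz hlz => ?_⟩
      by_contra hzy
      obtain ⟨P', h', hk⟩ := h.exists_reroute hy hz (Ne.symm hzy) e hlz
        (Joined.trans ⟨p, hpC⟩ hxl)
      have := hmin P' Q h' k hk p hpS
      omega
  -- then choose it with the other path as close to `x` as possible
  have hB : ∃ m, ∃ P Q : G.Walk u v, PathPair G S P Q ∧ (∃ y ∈ P.support, ∃ p : G.Walk y x,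
      (∀ t ∈ p.support, t ∈ S) ∧ p.length = Nat.find hA) ∧
      ∃ z ∈ Q.support, ∃ q : G.Walk z x, (∀ t ∈ q.support, t ∈ S ∧ t ∉ P.support) ∧
        q.length = m := by
    obtain ⟨P, Q, h, y, hy, p, hp, hl⟩ := Nat.find_spec hA
    obtain ⟨k, hky, hxk, honly⟩ := nearest P Q h y hy p hp hl
    have hxC := hcyc P Q h
    have hxy : x ≠ y := by
      rintro rfl
      exact hxC (PathPair.mem_cycle.2 (.inl hy))
    obtain ⟨t, ht, hty⟩ : ∃ t ∈ P.support, t ≠ y := by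
      by_cases huy : u = y
      exacts [⟨v, by simp, fun h => huv (huy.trans h.symm)⟩, ⟨u, by simp, huy⟩]
    obtain ⟨l, z, hxl, hlz, hzC, hzS⟩ := (hS y x hx t (h.left_mem t ht) hxy hty).exists_first_entry
      hxC (PathPair.mem_cycle.2 (.inl ht))
    have hxl' : Joined G (S \ (PathPair.cycle P Q).verts) x l :=
      hxl.mono fun s hs => ⟨hs.1.1, hs.2⟩
    have hzP : z ∉ P.support := fun hz => hzS.2 (honly l hxl' z hz hlz)
    obtain ⟨q, hq⟩ := hxl'.symm
    refine ⟨_, P, Q, h, ⟨y, hy, p, hp, hl⟩, z, (PathPair.mem_cycle.1 hzC).resolve_left hzP,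
      .cons hlz.symm q, ?_, rfl⟩
    simp only [Walk.support_cons, List.mem_cons]
    rintro s (rfl | hs)
    · exact ⟨hzS.1, hzP⟩
    · exact ⟨(hq s hs).1, fun hsP => (hq s hs).2 (PathPair.mem_cycle.2 (.inl hsP))⟩
  obtain ⟨P, Q, h, ⟨y, hy, p, hp, hl⟩, z, hz, q, hq, hm⟩ := Nat.find_spec hB
  have hxC := hcyc P Q h
  obtain ⟨k, hky, hxk, honly⟩ := nearest P Q h y hy p hp hl
  have hzP : z ∉ P.support := (hq z q.start_mem_support).2
  obtain ⟨l, hlz, hxl, honly'⟩ : ∃ l, G.Adj l z ∧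
      Joined G (S \ (PathPair.cycle P Q).verts) x l ∧
      ∀ l', Joined G (S \ (PathPair.cycle P Q).verts) x l' → ∀ z' ∈ Q.support, G.Adj l' z' →
        z' = z := by
    have hswap : PathPair.cycle Q P = PathPair.cycle P Q := sup_comm _ _
    cases q with
    | nil => exact absurd (PathPair.mem_cycle.2 (.inr hz)) hxC
    | @cons _ l _ e q =>
      have hqP : ∀ t ∈ q.support, t ∈ S ∧ t ∉ P.support := fun t ht => hq t (by simp [ht])
      simp only [Walk.length_cons] at hm
      have hqC : ∀ t ∈ q.support, t ∈ S \ (PathPair.cycle P Q).verts := by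
        refine fun t ht => ⟨(hqP t ht).1, fun htC => ?_⟩
        have htQ := (PathPair.mem_cycle.1 htC).resolve_left (hqP t ht).2
        have hlen := q.length_dropUntil_le_length ht
        have := Nat.find_min' hB ⟨P, Q, h, ⟨y, hy, p, hp, hl⟩, t, htQ, q.dropUntil t ht,
          fun t' ht' => hqP t' (q.support_dropUntil_subset_support ht ht'), rfl⟩
        omega
      refine ⟨l, e.symm, Joined.symm ⟨q, hqC⟩, fun l' hxl' z' hz' hlz' => ?_⟩
      by_contra hzz
      obtain ⟨Q', h', hlQ⟩ := h.symm.exists_reroute hz hz' (Ne.symm hzz) e hlz'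
        (hswap ▸ Joined.trans ⟨q, hqC⟩ hxl')
      have := Nat.find_min' hB ⟨P, Q', h'.symm, ⟨y, hy, p, hp, hl⟩, l, hlQ, q, hqP, rfl⟩
      omega
  have hyQ : y ∉ Q.support := fun hyQ => hzP (honly' k hxk y hyQ hky ▸ hy)
  refine ⟨P, Q, h, .inr ⟨hxC, k, y, l, z, hy, hyQ, hz, hzP, hky, hlz, hxk, hxl,
    fun k' hxk' y' hy' hk'y' => ?_⟩⟩
  rcases PathPair.mem_cycle.1 hy' with h' | h'
  · obtain rfl := honly k' hxk' y' h' hk'y'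
    exact .inl (h.isCycleSub.eq_of_adj hsc hy' hxk'.right_mem.2 hxk.right_mem.2 hk'y' hky)
  · obtain rfl := honly' k' hxk' y' h' hk'y'
    exact .inr (h.isCycleSub.eq_of_adj hsc hy' hxk'.right_mem.2 hxl.right_mem.2 hk'y' hlz)

lemma Joined.mem_of_closed {G : SimpleGraph V} {S T : Set V} {a b : V} (h : Joined G S a b)
    (ha : a ∈ T) (hT : ∀ y ∈ T, ∀ z ∈ S, G.Adj y z → z ∈ T) : b ∈ T := by
  by_contra hb
  obtain ⟨k, z, hk, hkz, hz, hzS⟩ := h.exists_first_entry (T := Tᶜ) (by simpa using ha) hb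
  exact hz (hT k (by simpa using hk.right_mem.2) z hzS hkz)

lemma Joined.mono_graph {G H : SimpleGraph V} {S : Set V} {a b : V} (h : Joined G S a b)
    (hGH : G ≤ H) : Joined H S a b := by
  obtain ⟨p, hp⟩ := h
  exact ⟨p.mapLe hGH, by simpa using hp⟩

/-- Walks whose edges lie in the subgraph `F` are walks of `F`. -/
lemma joined_spanningCoe {G : SimpleGraph V} {F : G.Subgraph} {S : Set V} {a b : V}
    (p : G.Walk a b) (hp : p.toSubgraph ≤ F) (hS : ∀ y ∈ p.support, y ∈ S) :
    Joined F.spanningCoe S a b := by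
  induction p with
  | nil => exact .refl (hS _ (by simp))
  | cons e p ih =>
    simp only [Walk.toSubgraph, sup_le_iff] at hp
    refine (Joined.of_adj (hp.1.2 (by simp)) (hS _ (by simp)) (hS _ (by simp))).trans
      (ih hp.2 fun y hy => hS y (by simp [hy]))

/-- The subgraph `F` is connected, phrased through walks of `G`. -/
lemma connected_iff_joined {G : SimpleGraph V} {F : G.Subgraph} :
    F.Connected ↔ F.verts.Nonempty ∧
      ∀ a ∈ F.verts, ∀ b ∈ F.verts, Joined F.spanningCoe F.verts a b := by
  rw [Subgraph.connected_iff_forall_exists_walk_subgraph]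
  refine and_congr_right fun _ => ⟨fun h a ha b hb => ?_, fun h a b ha hb => ?_⟩
  · obtain ⟨p, hp⟩ := h ha hb
    exact joined_spanningCoe p hp fun y hy => hp.1 (by simpa using hy)
  · obtain ⟨p, -⟩ := h a ha b hb
    have key : ∀ {a b : V} (p : F.spanningCoe.Walk a b), a ∈ F.verts →
        ∃ q : G.Walk a b, q.toSubgraph ≤ F := by
      intro a b p ha
      induction p with
      | nil => exact ⟨.nil, by simpa using! ha⟩
      | cons e p ih =>
        have e : F.Adj _ _ := e
        obtain ⟨q, hq⟩ := ih (F.edge_vert e.symm)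
        exact ⟨.cons (F.adj_sub e) q, by
          simpa only [Walk.toSubgraph, sup_le_iff] using ⟨subgraphOfAdj_le_of_adj F e, hq⟩⟩
    exact key p ha

lemma IsCycleSub.eq_of_le {G : SimpleGraph V} {C D : G.Subgraph} (hC : IsCycleSub C)
    (hD : IsCycleSub D) (h : C ≤ D) : C = D := by
  have hnb : ∀ y ∈ C.verts, C.neighborSet y = D.neighborSet y := fun y hy => by
    refine Set.eq_of_subset_of_ncard_le (fun z hz => h.2 hz) ?_
      (hD.1.subset (D.neighborSet_subset_verts y))
    rw [hC.2.2.2 y hy, hD.2.2.2 y (h.1 hy)]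
  have hadj : ∀ y ∈ C.verts, ∀ z, D.Adj y z → C.Adj y z := fun y hy z hz => by
    have : z ∈ D.neighborSet y := hz
    rwa [← hnb y hy] at this
  obtain ⟨a, ha⟩ := hC.2.1
  have hv : D.verts ⊆ C.verts := fun b hb =>
    ((connected_iff_joined.1 hD.2.2.1).2 a (h.1 ha) b hb).mem_of_closed ha
      fun y hy z _ hyz => C.edge_vert (hadj y hy z hyz).symm
  exact le_antisymm h ⟨hv, fun y z hyz => hadj y (hv (D.edge_vert hyz)) z hyz⟩

/-- The vertex `a` lies on a cycle of `F`. -/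
def OnCycle {G : SimpleGraph V} (F : G.Subgraph) (a : V) : Prop :=
  ∃ C ≤ F, IsCycleSub C ∧ a ∈ C.verts

lemma OnCycle.mono {G : SimpleGraph V} {F F' : G.Subgraph} {a : V} (h : OnCycle F a)
    (hF : F ≤ F') : OnCycle F' a := by
  obtain ⟨C, hC, h⟩ := h
  exact ⟨C, hC.trans hF, h⟩

/-- The subgraph `F` of a subcubic graph is a cactus. -/
structure CactusSub {G : SimpleGraph V} (F : G.Subgraph) : Prop where
  connected : F.Connected
  disjoint : ∀ C₁ ≤ F, ∀ C₂ ≤ F, IsCycleSub C₁ → IsCycleSub C₂ → C₁ ≠ C₂ →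
    Disjoint C₁.verts C₂.verts
  degree : ∀ a ∈ F.verts, ¬ OnCycle F a → (F.neighborSet a).ncard ≤ 2

/-- A non-cut vertex of `F` which is a leaf or lies on a cycle. -/
structure IsTip {G : SimpleGraph V} (F : G.Subgraph) (u : V) : Prop where
  mem : u ∈ F.verts
  joined : ∀ a ∈ F.verts, ∀ b ∈ F.verts, a ≠ u → b ≠ u →
    Joined F.spanningCoe (F.verts \ {u}) a b
  degree : ¬ OnCycle F u → (F.neighborSet u).ncard ≤ 1

lemma cactusSub_singleton {G : SimpleGraph V} (u : V) : CactusSub (G.singletonSubgraph u) where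
  connected := Subgraph.singletonSubgraph_connected
  disjoint C₁ h₁ C₂ h₂ hC₁ hC₂ := by
    exfalso
    obtain ⟨y, hy⟩ := hC₁.2.1
    have h := hC₁.2.2.2 y hy
    rw [show C₁.neighborSet y = ∅ from Set.eq_empty_of_forall_notMem fun z hz => h₁.2 hz] at h
    simp at h
  degree a ha _ := by
    rw [show (G.singletonSubgraph u).neighborSet a = ∅ from
      Set.eq_empty_of_forall_notMem fun z hz => hz]
    simp

lemma isTip_singleton {G : SimpleGraph V} (u : V) : IsTip (G.singletonSubgraph u) u where
  mem := by simp
  joined a ha b _ hau := absurd (by simpa using ha) hau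
  degree _ := by
    rw [show (G.singletonSubgraph u).neighborSet u = ∅ from
      Set.eq_empty_of_forall_notMem fun z hz => hz]
    simp

lemma IsCycleSub.cactusSub {G : SimpleGraph V} {C : G.Subgraph} (hC : IsCycleSub C) :
    CactusSub C where
  connected := hC.2.2.1
  disjoint _ h₁ _ h₂ hC₁ hC₂ hne :=
    absurd ((hC₁.eq_of_le hC h₁).trans (hC₂.eq_of_le hC h₂).symm) hne
  degree _ ha h := absurd ⟨C, le_rfl, hC, ha⟩ h

lemma joined_end_of_isPath {G : SimpleGraph V} {F : G.Subgraph} {u v a : V}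
    {P : G.Walk u v} (hP : P.IsPath) (hPF : P.toSubgraph ≤ F) (ha : a ∈ P.support) (hau : a ≠ u) :
    Joined F.spanningCoe (F.verts \ {u}) a v := by
  obtain ⟨A, B, rfl⟩ := P.mem_support_iff_exists_append.1 ha
  rw [Walk.toSubgraph_append, sup_le_iff] at hPF
  refine joined_spanningCoe B hPF.2 fun y hy => ⟨hPF.2.1 (by simpa using hy), ?_⟩
  rintro rfl
  exact hau ((isPath_append_iff.1 hP).2.2 _ A.start_mem_support hy).symm

lemma PathPair.isTip_left {G : SimpleGraph V} {S : Set V} {u v : V} {P Q : G.Walk u v}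
    (h : PathPair G S P Q) : IsTip (PathPair.cycle P Q) u where
  mem := PathPair.mem_cycle.2 (.inl P.start_mem_support)
  joined a ha b hb hau hbu := by
    have key : ∀ a ∈ (PathPair.cycle P Q).verts, a ≠ u → Joined (PathPair.cycle P Q).spanningCoe
        ((PathPair.cycle P Q).verts \ {u}) a v := by
      intro a ha hau
      rcases PathPair.mem_cycle.1 ha with ha | ha
      exacts [joined_end_of_isPath h.isPath_left le_sup_left ha hau,
        joined_end_of_isPath h.isPath_right le_sup_right ha hau]
    exact (key a ha hau).trans (key b hb hbu).symm
  degree h' := absurd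
    ⟨_, le_rfl, h.isCycleSub, PathPair.mem_cycle.2 (.inl P.start_mem_support)⟩ h'

lemma PathPair.isTip_right {G : SimpleGraph V} {S : Set V} {u v : V} {P Q : G.Walk u v}
    (h : PathPair G S P Q) : IsTip (PathPair.cycle P Q) v := by
  have h' : PathPair G S P.reverse Q.reverse :=
    ⟨h.isPath_left.reverse, h.isPath_right.reverse, by simpa using h.left_mem,
      by simpa using h.right_mem, fun e => h.ne (by simpa using congrArg Walk.reverse e),
      by simpa [or_comm] using h.disj⟩
  have e : PathPair.cycle P.reverse Q.reverse = PathPair.cycle P Q := by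
    simp [PathPair.cycle]
  exact e ▸ h'.isTip_left

/-- `F` arises from the disjoint subgraphs `F₁` and `F₂` by adding the edge `ab`. -/
structure BridgeJoin {G : SimpleGraph V} (F F₁ F₂ : G.Subgraph) (a b : V) : Prop where
  disj : ∀ y ∈ F₁.verts, y ∉ F₂.verts
  verts : ∀ y, y ∈ F.verts ↔ y ∈ F₁.verts ∨ y ∈ F₂.verts
  left_mem : a ∈ F₁.verts
  right_mem : b ∈ F₂.verts
  adj : ∀ y z, F.Adj y z ↔ F₁.Adj y z ∨ F₂.Adj y z ∨ (y = a ∧ z = b) ∨ (y = b ∧ z = a)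

lemma exists_bridgeJoin {G : SimpleGraph V} {F₁ F₂ : G.Subgraph} {a b : V}
    (hd : ∀ y ∈ F₁.verts, y ∉ F₂.verts) (ha : a ∈ F₁.verts) (hb : b ∈ F₂.verts)
    (hab : G.Adj a b) : ∃ F : G.Subgraph, BridgeJoin F F₁ F₂ a b := by
  refine ⟨F₁ ⊔ F₂ ⊔ G.subgraphOfAdj hab, hd, fun y => ?_, ha, hb, fun y z => ?_⟩
  · simp only [Subgraph.verts_sup, Set.mem_union, subgraphOfAdj_verts, Set.mem_insert_iff,
      Set.mem_singleton_iff]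
    constructor
    · rintro (h | rfl | rfl)
      exacts [h, .inl ha, .inr hb]
    · exact .inl
  · simp only [Subgraph.sup_adj, subgraphOfAdj_adj, Sym2.eq_iff, or_assoc]
    grind

namespace BridgeJoin

variable {G : SimpleGraph V} {F F₁ F₂ : G.Subgraph} {a b : V}

lemma symm (h : BridgeJoin F F₁ F₂ a b) : BridgeJoin F F₂ F₁ b a where
  disj y hy hy' := h.disj y hy' hy
  verts y := (h.verts y).trans or_comm
  left_mem := h.right_mem
  right_mem := h.left_mem
  adj y z := by rw [h.adj]; tauto

lemma left_le (h : BridgeJoin F F₁ F₂ a b) : F₁ ≤ F :=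
  ⟨fun y hy => (h.verts y).2 (.inl hy), fun y z hyz => (h.adj y z).2 (.inl hyz)⟩

lemma adj_left (h : BridgeJoin F F₁ F₂ a b) {y z : V} (hy : y ∈ F₁.verts) :
    F.Adj y z ↔ F₁.Adj y z ∨ (y = a ∧ z = b) := by
  rw [h.adj]
  refine ⟨?_, fun h => h.imp_right fun h => .inr (.inl h)⟩
  rintro (h' | h' | h' | ⟨rfl, rfl⟩)
  exacts [.inl h', absurd (F₂.edge_vert h') (h.disj y hy), .inr h', absurd h.right_mem (h.disj _ hy)]

lemma not_adj_of_isCycleSub (h : BridgeJoin F F₁ F₂ a b) {C : G.Subgraph} (hCF : C ≤ F)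
    (hC : IsCycleSub C) : ¬ C.Adj a b := by
  classical
  intro hab
  have hfin : Fintype ↥(C.verts ∩ F₁.verts) := (hC.1.inter_of_left _).fintype
  let H := C.spanningCoe.induce (C.verts ∩ F₁.verts)
  have hdeg : ∀ y : ↥(C.verts ∩ F₁.verts), H.degree y = (C.neighborSet y ∩ F₁.verts).ncard := by
    intro y
    have e : C.neighborSet y ∩ F₁.verts = Subtype.val '' (H.neighborSet y) := by
      ext z
      constructor
      · rintro ⟨hz, hz'⟩
        exact ⟨⟨z, C.neighborSet_subset_verts _ hz, hz'⟩, hz, rfl⟩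
      · rintro ⟨z, hz, rfl⟩
        exact ⟨hz, z.2.2⟩
    rw [e, Set.ncard_image_of_injective _ Subtype.val_injective, ← card_neighborSet_eq_degree,
      Set.ncard_eq_toFinset_card', Set.toFinset_card]
  have haC : a ∈ C.verts := C.edge_vert hab
  have hodd : Odd (H.degree ⟨a, haC, h.left_mem⟩) := by
    have e : C.neighborSet a ∩ F₁.verts = C.neighborSet a \ {b} := by
      ext z
      refine and_congr_right fun hz => ?_
      constructor
      · rintro hz' rfl
        exact h.disj _ hz' h.right_mem
      · intro hzb
        rcases (h.adj_left h.left_mem).1 (hCF.2 hz) with h' | h'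
        exacts [F₁.edge_vert h'.symm, absurd h'.2 hzb]
    rw [hdeg, e, Set.ncard_sdiff_singleton_of_mem (by exact hab), hC.2.2.2 a haC]
    exact odd_one
  obtain ⟨y, hya, hy⟩ := H.exists_ne_odd_degree_of_exists_odd_degree _ hodd
  have e : C.neighborSet y ∩ F₁.verts = C.neighborSet y := by
    refine Set.inter_eq_left.2 fun z hz => ?_
    rcases (h.adj_left y.2.2).1 (hCF.2 hz) with h' | h'
    exacts [F₁.edge_vert h'.symm, absurd (Subtype.ext h'.1) hya]
  rw [hdeg, e, hC.2.2.2 y y.2.1] at hy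
  exact absurd hy (by decide)

lemma le_left_of_mem (h : BridgeJoin F F₁ F₂ a b) {C : G.Subgraph} (hCF : C ≤ F)
    (hC : IsCycleSub C) {y : V} (hy : y ∈ C.verts) (hy' : y ∈ F₁.verts) : C ≤ F₁ := by
  have hadj : ∀ y ∈ F₁.verts, ∀ z, C.Adj y z → F₁.Adj y z := by
    intro y hy z hyz
    rcases (h.adj_left hy).1 (hCF.2 hyz) with h' | ⟨rfl, rfl⟩
    exacts [h', absurd hyz (h.not_adj_of_isCycleSub hCF hC)]
  have hv : C.verts ⊆ F₁.verts := fun z hz =>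
    ((connected_iff_joined.1 hC.2.2.1).2 y hy z hz).mem_of_closed hy'
      fun y hy z _ hyz => F₁.edge_vert (hadj y hy z hyz).symm
  exact ⟨hv, fun y z hyz => hadj y (hv (C.edge_vert hyz)) z hyz⟩

lemma le_or_le (h : BridgeJoin F F₁ F₂ a b) {C : G.Subgraph} (hCF : C ≤ F)
    (hC : IsCycleSub C) : C ≤ F₁ ∨ C ≤ F₂ := by
  obtain ⟨y, hy⟩ := hC.2.1
  rcases (h.verts y).1 (hCF.1 hy) with h' | h'
  exacts [.inl (h.le_left_of_mem hCF hC hy h'), .inr (h.symm.le_left_of_mem hCF hC hy h')]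

lemma joined_left (h : BridgeJoin F F₁ F₂ a b) (h₁ : F₁.Connected) {y : V}
    (hy : y ∈ F₁.verts) : Joined F.spanningCoe F₁.verts y a :=
  ((connected_iff_joined.1 h₁).2 y hy a h.left_mem).mono_graph
    (Subgraph.spanningCoe_le_of_le h.left_le)

lemma degree_left (h : BridgeJoin F F₁ F₂ a b) (h₁ : CactusSub F₁)
    (ha : ¬ OnCycle F₁ a → (F₁.neighborSet a).ncard ≤ 1) {y : V} (hy : y ∈ F₁.verts)
    (hyc : ¬ OnCycle F y) : (F.neighborSet y).ncard ≤ 2 := by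
  have hyc₁ : ¬ OnCycle F₁ y := fun h' => hyc (h'.mono h.left_le)
  by_cases hya : y = a
  · subst hya
    have : F.neighborSet y ⊆ insert b (F₁.neighborSet y) := fun z hz =>
      ((h.adj_left hy).1 hz).symm.imp And.right id
    have e : insert b (F₁.neighborSet y) ⊆ F.neighborSet y := by
      rintro z (rfl | hz)
      exacts [(h.adj_left hy).2 (.inr ⟨rfl, rfl⟩), h.left_le.2 hz]
    rw [this.antisymm e]
    exact (Set.ncard_insert_le _ _).trans (Nat.succ_le_succ (ha hyc₁))
  · have : F.neighborSet y = F₁.neighborSet y := by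
      ext z
      exact (h.adj_left hy).trans (by simp [hya])
    rw [this]
    exact h₁.degree y hy hyc₁

lemma cactusSub (h : BridgeJoin F F₁ F₂ a b) (h₁ : CactusSub F₁) (h₂ : CactusSub F₂)
    (ha : ¬ OnCycle F₁ a → (F₁.neighborSet a).ncard ≤ 1)
    (hb : ¬ OnCycle F₂ b → (F₂.neighborSet b).ncard ≤ 1) : CactusSub F where
  connected := by
    have key : ∀ y ∈ F.verts, Joined F.spanningCoe F.verts y a := by
      intro y hy
      rcases (h.verts y).1 hy with hy | hy
      · exact (h.joined_left h₁.connected hy).mono h.left_le.1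
      · refine ((h.symm.joined_left h₂.connected hy).mono h.symm.left_le.1).trans (.of_adj ?_
          (h.symm.left_le.1 h.right_mem) (h.left_le.1 h.left_mem))
        exact (h.adj b a).2 (by simp)
    exact connected_iff_joined.2
      ⟨⟨a, h.left_le.1 h.left_mem⟩, fun y hy z hz => (key y hy).trans (key z hz).symm⟩
  disjoint C₁ hF₁ C₂ hF₂ hC₁ hC₂ hne := by
    rcases h.le_or_le hF₁ hC₁ with h' | h' <;> rcases h.le_or_le hF₂ hC₂ with h'' | h''
    · exact h₁.disjoint _ h' _ h'' hC₁ hC₂ hne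
    · exact Set.disjoint_left.2 fun y hy hy' => h.disj y (h'.1 hy) (h''.1 hy')
    · exact Set.disjoint_left.2 fun y hy hy' => h.disj y (h''.1 hy') (h'.1 hy)
    · exact h₂.disjoint _ h' _ h'' hC₁ hC₂ hne
  degree y hy hyc := by
    rcases (h.verts y).1 hy with hy | hy
    exacts [h.degree_left h₁ ha hy hyc, h.symm.degree_left h₂ hb hy hyc]

lemma isTip (h : BridgeJoin F F₁ F₂ a b) (h₂ : F₂.Connected) {u : V} (hu : IsTip F₁ u)
    (hua : u = a → F₁.verts = {u}) : IsTip F u where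
  mem := h.left_le.1 hu.mem
  joined := by
    have h2le : F₂.verts ⊆ F.verts \ {u} := fun y hy =>
      ⟨h.symm.left_le.1 hy, fun e => h.disj u hu.mem ((show y = u from e) ▸ hy)⟩
    have key : ∀ y ∈ F.verts, y ≠ u → Joined F.spanningCoe (F.verts \ {u}) y b := by
      intro y hy hyu
      rcases (h.verts y).1 hy with hy | hy
      · have hau : a ≠ u := by
          rintro rfl
          rw [hua rfl] at hy
          exact hyu hy
        refine (((hu.joined y hy a h.left_mem hyu hau).mono_graph
          (Subgraph.spanningCoe_le_of_le h.left_le)).mono (Set.sdiff_subset_sdiff_left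
            h.left_le.1)).trans (.of_adj ?_ ⟨h.left_le.1 h.left_mem, hau⟩ (h2le h.right_mem))
        exact (h.adj a b).2 (by simp)
      · exact (h.symm.joined_left h₂ hy).mono h2le
    exact fun y hy z hz hyu hzu => (key y hy hyu).trans (key z hz hzu).symm
  degree hc := by
    have hc₁ : ¬ OnCycle F₁ u := fun h' => hc (h'.mono h.left_le)
    by_cases hu' : u = a
    · have : F.neighborSet u ⊆ {b} := fun z hz => by
        rcases (h.adj_left hu.mem).1 hz with h' | h'
        · have hz : z ∈ F₁.verts := F₁.edge_vert h'.symm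
          rw [hua hu'] at hz
          exact absurd (F₁.adj_sub h') (by rw [show z = u from hz]; exact G.irrefl)
        · exact h'.2
      exact (Set.ncard_le_ncard this).trans (by simp)
    · have : F.neighborSet u = F₁.neighborSet u := by
        ext z
        exact (h.adj_left hu.mem).trans (by simp [hu'])
      rw [this]
      exact hu.degree hc₁

end BridgeJoin

lemma Joined.inter_of_closed {G : SimpleGraph V} {S T : Set V} {a b : V} (h : Joined G S a b)
    (ha : a ∈ T) (hT : ∀ y ∈ T, ∀ z ∈ S, G.Adj y z → z ∈ T) : Joined G (S ∩ T) a b := by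
  obtain ⟨p, hp⟩ := h
  exact ⟨p, fun y hy => ⟨hp y hy,
    (joined_of_mem_support hp p.start_mem_support hy).mem_of_closed ha hT⟩⟩

/-- `F` is a finite cactus in `G[S]` containing `x` with tips `u` and `v`, and every component of
`G[S] - F` attaches to a single cycle of `F`. -/
structure IsCactusCore (G : SimpleGraph V) (S : Set V) (u v x : V) (F : G.Subgraph) : Prop where
  finite : F.verts.Finite
  subset : F.verts ⊆ S
  mem : x ∈ F.verts
  cactusSub : CactusSub F
  left : IsTip F u
  right : IsTip F v
  attach : ∀ w ∈ S, w ∉ F.verts → ∃ C ≤ F, IsCycleSub C ∧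
    ∀ k y, Joined G (S \ F.verts) w k → y ∈ F.verts → G.Adj k y → y ∈ C.verts

lemma IsCactusCore.symm {G : SimpleGraph V} {S : Set V} {u v x : V} {F : G.Subgraph}
    (h : IsCactusCore G S u v x F) : IsCactusCore G S v u x F :=
  ⟨h.finite, h.subset, h.mem, h.cactusSub, h.right, h.left, h.attach⟩

lemma isCactusCore_singleton {G : SimpleGraph V} {u : V} :
    IsCactusCore G {u} u u u (G.singletonSubgraph u) where
  finite := by simp
  subset := by simp
  mem := by simp
  cactusSub := cactusSub_singleton u
  left := isTip_singleton u
  right := isTip_singleton u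
  attach w hw hw' := absurd (by simpa using hw) hw'

/-- `ab` is the only edge of `G[S]` between its sides `S₁ ∋ u` and `S₂ ∋ v`. -/
structure IsBridge (G : SimpleGraph V) (S S₁ S₂ : Set V) (u a b v : V) : Prop where
  mem_iff : ∀ y, y ∈ S ↔ y ∈ S₁ ∨ y ∈ S₂
  disj : ∀ y ∈ S₁, y ∉ S₂
  left_mem : u ∈ S₁
  right_mem : v ∈ S₂
  left_end_mem : a ∈ S₁
  right_end_mem : b ∈ S₂
  adj : G.Adj a b
  unique : ∀ y ∈ S₁, ∀ z ∈ S₂, G.Adj y z → y = a ∧ z = b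

namespace IsBridge

variable {G : SimpleGraph V} {S S₁ S₂ : Set V} {u a b v : V}

lemma symm (h : IsBridge G S S₁ S₂ u a b v) : IsBridge G S S₂ S₁ v b a u where
  mem_iff y := (h.mem_iff y).trans or_comm
  disj y hy hy' := h.disj y hy' hy
  left_mem := h.right_mem
  right_mem := h.left_mem
  left_end_mem := h.right_end_mem
  right_end_mem := h.left_end_mem
  adj := h.adj.symm
  unique y hy z hz hyz := (h.unique z hz y hy hyz.symm).symm

lemma exit (h : IsBridge G S S₁ S₂ u a b v) :
    ∀ k ∈ S₁, ∀ y ∈ S, y ∉ S₁ → G.Adj k y → k = u ∨ k = a := fun k hk y hy hy' hky =>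
  .inr (h.unique k hk y (((h.mem_iff y).1 hy).resolve_left hy') hky).1

lemma exists_walk (h : IsBridge G S S₁ S₂ u a b v) (q : G.Walk u v)
    (hq : ∀ y ∈ q.support, y ∈ S) :
    ∃ r : G.Walk u a, (∀ y ∈ r.support, y ∈ S₁) ∧ r.length < q.length := by
  obtain ⟨k, z, r, hkz, hz, -, hr, hl⟩ := exists_first_entry q (h.disj u h.left_mem)
    ⟨v, q.end_mem_support, h.right_mem⟩
  have hr' : ∀ y ∈ r.support, y ∈ S₁ := fun y hy =>
    ((h.mem_iff y).1 (hq y (hr y hy).1)).resolve_right (hr y hy).2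
  obtain rfl := (h.unique k (hr' k r.end_mem_support) z hz hkz).1
  exact ⟨r, hr', hl⟩

lemma linked (h : IsBridge G S S₁ S₂ u a b v) (hS : Linked G S u v) : Linked G S₁ u a := by
  obtain ⟨q, hq⟩ := hS.symm.joined u hS.left_mem
  obtain ⟨r, hr, -⟩ := h.exists_walk q hq
  exact hS.of_exits (fun y hy => (h.mem_iff y).2 (.inl hy)) h.left_mem h.left_end_mem ⟨r, hr⟩
    h.exit (fun _ => .inl rfl) fun hv => absurd h.right_mem (h.disj v hv)

lemma attach_left {F F₁ F₂ : G.Subgraph} (h : IsBridge G S S₁ S₂ u a b v) {x x' : V}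
    (h₁ : IsCactusCore G S₁ u a x F₁) (h₂ : IsCactusCore G S₂ b v x' F₂)
    (hF : BridgeJoin F F₁ F₂ a b) {w : V} (hw : w ∈ S₁) (hwF : w ∉ F.verts) :
    ∃ C ≤ F, IsCycleSub C ∧
      ∀ k y, Joined G (S \ F.verts) w k → y ∈ F.verts → G.Adj k y → y ∈ C.verts := by
  obtain ⟨C, hC, hCc, hCa⟩ := h₁.attach w hw fun h' => hwF (hF.left_le.1 h')
  refine ⟨C, hC.trans hF.left_le, hCc, fun k y hk hy hky => ?_⟩
  have hk' := hk.inter_of_closed (T := S₁) hw fun s hs t ht hst => by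
    refine ((h.mem_iff t).1 ht.1).resolve_right fun ht' => ht.2 ?_
    rw [(h.unique s hs t ht' hst).2]
    exact hF.symm.left_le.1 hF.right_mem
  have hkS := hk'.right_mem
  refine hCa k y (hk'.mono fun t ht => ⟨ht.2, fun h' => ht.1.2 (hF.left_le.1 h')⟩) ?_ hky
  refine ((hF.verts y).1 hy).resolve_right fun hy₂ => hkS.1.2 ?_
  rw [(h.unique k hkS.2 y (h₂.subset hy₂) hky).1]
  exact hF.left_le.1 hF.left_mem

lemma isCactusCore {F₁ F₂ : G.Subgraph} (h : IsBridge G S S₁ S₂ u a b v) (hS : Linked G S u v)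
    {x x' : V} (h₁ : IsCactusCore G S₁ u a x F₁) (h₂ : IsCactusCore G S₂ b v x' F₂) :
    ∃ F : G.Subgraph, IsCactusCore G S u v x F := by
  obtain ⟨F, hF⟩ := exists_bridgeJoin (fun y hy hy' => h.disj y (h₁.subset hy) (h₂.subset hy'))
    h₁.right.mem h₂.left.mem h.adj
  have hu : u = a → F₁.verts = {u} := by
    rintro rfl
    exact Set.Subset.antisymm (h₁.subset.trans (h.linked hS).eq_singleton.le)
      (by simpa using h₁.left.mem)
  have hv : v = b → F₂.verts = {v} := by
    rintro rfl
    exact Set.Subset.antisymm (h₂.subset.trans (h.symm.linked hS.symm).eq_singleton.le)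
      (by simpa using h₂.left.mem)
  have hFe : F.verts = F₁.verts ∪ F₂.verts := Set.ext hF.verts
  refine ⟨F, hFe ▸ h₁.finite.union h₂.finite, fun y hy => ?_, hF.left_le.1 h₁.mem,
    hF.cactusSub h₁.cactusSub h₂.cactusSub h₁.right.degree h₂.left.degree,
    hF.isTip h₂.cactusSub.connected h₁.left hu,
    hF.symm.isTip h₁.cactusSub.connected h₂.right hv, fun w hw hwF => ?_⟩
  · exact (h.mem_iff y).2 (((hF.verts y).1 hy).imp (h₁.subset ·) (h₂.subset ·))
  · rcases (h.mem_iff w).1 hw with hw | hw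
    exacts [attach_left h h₁ h₂ hF hw hwF, attach_left h.symm h₂.symm h₁.symm hF.symm hw hwF]

end IsBridge

/-- Cactus cores exist as long as `x` is at distance at most `n` from `u` or `v`, and `u` and `v`
are at distance at most `m`. -/
def HasCores (G : SimpleGraph V) (n m : ℕ) : Prop :=
  ∀ (S : Set V) (u v x : V), Linked G S u v →
    (∃ (d : V) (p : G.Walk x d), (d = u ∨ d = v) ∧ (∀ y ∈ p.support, y ∈ S) ∧ p.length ≤ n) →
    (∃ q : G.Walk u v, (∀ y ∈ q.support, y ∈ S) ∧ q.length ≤ m) →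
    ∃ F : G.Subgraph, IsCactusCore G S u v x F

lemma exists_core_of_bridge {G : SimpleGraph V} {n m : ℕ} (ih : ∀ m' < m, HasCores G n m')
    {S S₁ S₂ : Set V} {u a b v x : V} (hS : Linked G S u v) (h : IsBridge G S S₁ S₂ u a b v)
    {d : V} {p : G.Walk x d} (hd : d = u ∨ d = v) (hp : ∀ y ∈ p.support, y ∈ S)
    (hn : p.length ≤ n) {q : G.Walk u v} (hq : ∀ y ∈ q.support, y ∈ S) (hm : q.length ≤ m)
    (hx : x ∈ S₁) : ∃ F : G.Subgraph, IsCactusCore G S u v x F := by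
  obtain ⟨r, hr, hrl⟩ := h.exists_walk q hq
  obtain ⟨s, hs, hsl⟩ := h.symm.exists_walk q.reverse (by simpa using hq)
  rw [Walk.length_reverse] at hsl
  obtain ⟨e, t, he, ht, htl, -⟩ := Linked.exists_walk_of_exits h.exit subset_rfl hx
    (fun hdS => .inl (hd.resolve_right fun e => h.disj d hdS (e ▸ h.right_mem))) p hp
  obtain ⟨F₁, h₁⟩ := ih r.length (by omega) S₁ u a x (h.linked hS)
    ⟨e, t, he, fun y hy => (ht y hy).1, htl.trans hn⟩ ⟨r, hr, le_rfl⟩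
  obtain ⟨F₂, h₂⟩ := ih s.length (by omega) S₂ b v b (h.symm.linked hS.symm).symm
    ⟨b, .nil, .inl rfl, by simpa using h.right_end_mem, by simp⟩
    ⟨s.reverse, by simpa using hs, by simp⟩
  exact h.isCactusCore hS h₁ h₂

section NoBridge

variable {G : SimpleGraph V} {S : Set V} {u v : V}

lemma exists_two_adj_start (h : Linked G S u v) (huv : u ≠ v)
    (hb : ∀ S₁ S₂ a b, ¬ IsBridge G S S₁ S₂ u a b v) :
    ∃ a ∈ S, ∃ b ∈ S, a ≠ b ∧ G.Adj u a ∧ G.Adj u b := by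
  obtain ⟨a, z, ha, haz, hz, -⟩ := (h.joined v h.right_mem).exists_first_entry (T := {u})
    (by simpa using huv.symm) rfl
  obtain rfl : z = u := hz
  have haS := ha.right_mem
  by_contra! hcon
  refine hb {z} (S \ {z}) z a ⟨fun y => ?_, by simp, rfl, ⟨h.right_mem, huv.symm⟩, rfl, haS,
    haz.symm, ?_⟩
  · have := h.left_mem
    by_cases hy : y = z <;> simp [hy, this]
  · rintro y rfl t ht hyt
    refine ⟨rfl, ?_⟩
    by_contra hta
    exact hcon t ht.1 a haS.1 hta hyt haz.symm

lemma exists_two_adj_cut (h : Linked G S u v) (hb : ∀ S₁ S₂ a b, ¬ IsBridge G S S₁ S₂ u a b v)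
    {c : V} (hc : c ∈ S) (hcu : u ≠ c) (hcv : v ≠ c) (hsep : ¬ Joined G (S \ {c}) u v) :
    ∃ a b, a ≠ b ∧ G.Adj c a ∧ G.Adj c b ∧ Joined G (S \ {c}) a u ∧ Joined G (S \ {c}) b u := by
  obtain ⟨a, z, ha, haz, hz, -⟩ := (h.joined c hc).symm.exists_first_entry (T := {c})
    (by simpa using hcu) rfl
  obtain rfl : z = c := hz
  by_contra! hcon
  refine hb {y | Joined G (S \ {z}) y u} {y | y ∈ S ∧ ¬ Joined G (S \ {z}) y u} a z
    ⟨fun y => ?_, fun y hy hy' => hy'.2 hy, Joined.refl ha.left_mem,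
      ⟨h.right_mem, fun h' => hsep h'.symm⟩, ha.symm, ⟨hc, fun h' => h'.left_mem.2 rfl⟩, haz,
      fun y hy t ht hyt => ?_⟩
  · by_cases hy : Joined G (S \ {z}) y u
    · simpa [hy] using hy.left_mem.1
    · simp [hy]
  · have htz : t = z := by
      by_contra htz
      have hy : Joined G (S \ {z}) y u := hy
      have hty : Joined G (S \ {z}) t y := .of_adj hyt.symm ⟨ht.1, htz⟩ hy.left_mem
      exact ht.2 (hty.trans hy)
    subst htz
    refine ⟨?_, rfl⟩
    by_contra hya
    exact hcon y a hya hyt.symm haz.symm hy ha.symm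

lemma noCut_of_noBridge (hsc : Subcubic G) (h : Linked G S u v)
    (hb : ∀ S₁ S₂ a b, ¬ IsBridge G S S₁ S₂ u a b v) : NoCut G S := by
  intro c w hw w' hw' hwc hwc'
  by_cases hc : c ∈ S
  swap
  · exact ((h.joined w hw).trans (h.joined w' hw').symm).mono
      fun y hy => ⟨hy, fun e => hc ((show y = c from e) ▸ hy)⟩
  by_contra hcon
  have hsep : ¬ Joined G (S \ {c}) u v ∧ u ≠ c ∧ v ≠ c := by
    rcases h.avoid c hc w hw hwc with h₁ | h₁ <;>
      rcases h.avoid c hc w' hw' hwc' with h₂ | h₂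
    · exact absurd (h₁.trans h₂.symm) hcon
    · exact ⟨fun h' => hcon (h₁.trans (h'.trans h₂.symm)), h₁.right_mem.2, h₂.right_mem.2⟩
    · exact ⟨fun h' => hcon (h₁.trans (h'.symm.trans h₂.symm)), h₂.right_mem.2, h₁.right_mem.2⟩
    · exact absurd (h₁.trans h₂.symm) hcon
  obtain ⟨hsep, hcu, hcv⟩ := hsep
  obtain ⟨a, b, hab, hca, hcb, hau, hbu⟩ := exists_two_adj_cut h hb hc hcu hcv hsep
  obtain ⟨a', b', hab', hca', hcb', hau', hbu'⟩ := exists_two_adj_cut h.symm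
    (fun S₁ S₂ a b h' => hb _ _ _ _ h'.symm) hc hcv hcu fun h' => hsep h'.symm
  have hne : ∀ {s t}, Joined G (S \ {c}) s u → Joined G (S \ {c}) t v → s ≠ t := by
    rintro s t hs ht rfl
    exact hsep (hs.symm.trans ht)
  have h4 : ({a, b} ∪ {a', b'} : Set V) ⊆ G.neighborSet c := by
    rintro t ((rfl | rfl) | rfl | rfl)
    exacts [hca, hcb, hca', hcb']
  have hd : Disjoint ({a, b} : Set V) {a', b'} := by
    rw [Set.disjoint_left]
    rintro t (rfl | rfl) (e | e)
    exacts [hne hau hau' e, hne hau hbu' e, hne hbu hau' e, hne hbu hbu' e]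
  have h₁ := Set.ncard_le_ncard h4 (hsc c).1
  rw [Set.ncard_union_eq hd, Set.ncard_pair hab, Set.ncard_pair hab'] at h₁
  have := (hsc c).2
  omega

end NoBridge

lemma exists_core_of_cycle {G : SimpleGraph V} {S : Set V} {u v x k l y : V}
    {P Q : G.Walk u v} (h : PathPair G S P Q)
    (hyP : y ∈ P.support) (hyQ : y ∉ Q.support)
    (hky : G.Adj k y)
    (hexit : ∀ k', Joined G (S \ (PathPair.cycle P Q).verts) x k' →
      ∀ y' ∈ (PathPair.cycle P Q).verts, G.Adj k' y' → k' = k ∨ k' = l)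
    {F₂ : G.Subgraph}
    (h₂ : IsCactusCore G {t | Joined G (S \ (PathPair.cycle P Q).verts) x t} k l x F₂) :
    ∃ F : G.Subgraph, IsCactusCore G S u v x F := by
  set C := PathPair.cycle P Q with hCdef
  have hyC : y ∈ C.verts := PathPair.mem_cycle.2 (.inl hyP)
  have hCc : IsCycleSub C := h.isCycleSub
  have hd : ∀ t ∈ C.verts, t ∉ F₂.verts := fun t ht ht' => (h₂.subset ht').right_mem.2 ht
  obtain ⟨F, hF⟩ := exists_bridgeJoin hd hyC h₂.left.mem hky.symm
  have hFe : F.verts = C.verts ∪ F₂.verts := Set.ext hF.verts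
  refine ⟨F, hFe ▸ hCc.1.union h₂.finite, fun t ht => ?_, hF.symm.left_le.1 h₂.mem,
    hF.cactusSub hCc.cactusSub h₂.cactusSub (fun h' => absurd ⟨C, le_rfl, hCc, hyC⟩ h')
      h₂.left.degree, hF.isTip h₂.cactusSub.connected h.isTip_left ?_,
    hF.isTip h₂.cactusSub.connected h.isTip_right ?_, fun w hw hwF => ?_⟩
  · rcases (hF.verts t).1 ht with ht | ht
    · rcases PathPair.mem_cycle.1 ht with ht | ht
      exacts [h.left_mem t ht, h.right_mem t ht]
    · exact (h₂.subset ht).right_mem.1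
  · rintro rfl
    exact absurd Q.start_mem_support hyQ
  · rintro rfl
    exact absurd Q.end_mem_support hyQ
  · have hclosed : ∀ s ∈ {t | Joined G (S \ C.verts) x t}, ∀ t ∈ S \ F.verts, G.Adj s t →
        t ∈ {t | Joined G (S \ C.verts) x t} := fun s hs t ht hst =>
      hs.trans (.of_adj hst hs.right_mem ⟨ht.1, fun h' => ht.2 (hF.left_le.1 h')⟩)
    by_cases hwK : Joined G (S \ C.verts) x w
    · obtain ⟨D, hD, hDc, hDa⟩ := h₂.attach w hwK fun h' => hwF (hF.symm.left_le.1 h')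
      refine ⟨D, hD.trans hF.symm.left_le, hDc, fun k' y' hk' hy' hky' => ?_⟩
      have hk'' := hk'.inter_of_closed hwK hclosed
      refine hDa k' y' (hk''.mono fun t ht => ⟨ht.2, fun h' => ht.1.2 (hF.symm.left_le.1 h')⟩)
        (((hF.verts y').1 hy').resolve_left fun hyC' => hk'.right_mem.2 ?_) hky'
      rcases hexit k' hk''.right_mem.2 y' hyC' hky' with rfl | rfl
      exacts [hF.symm.left_le.1 h₂.left.mem, hF.symm.left_le.1 h₂.right.mem]
    · refine ⟨C, hF.left_le, hCc, fun k' y' hk' hy' hky' => ?_⟩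
      refine ((hF.verts y').1 hy').resolve_right fun hy₂ => hwK ?_
      have hkS := hk'.right_mem
      have hk'' : Joined G (S \ C.verts) x k' := (h₂.subset hy₂).trans (.of_adj hky'.symm
        (h₂.subset hy₂).right_mem ⟨hkS.1, fun h' => hkS.2 (hF.left_le.1 h')⟩)
      exact hk'.symm.mem_of_closed hk'' hclosed

lemma hasCores {G : SimpleGraph V} (hsc : Subcubic G) (n m : ℕ) : HasCores G n m := by
  induction n using Nat.strong_induction_on generalizing m with
  | _ n ihn =>
  induction m using Nat.strong_induction_on with
  | _ m ihm =>
  rintro S u v x hS ⟨d, p, hd, hp, hn⟩ ⟨q, hq, hm⟩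
  have hx : x ∈ S := hp x p.start_mem_support
  by_cases huv : u = v
  · subst huv
    obtain rfl := hS.eq_singleton
    obtain rfl : x = u := hx
    exact ⟨_, isCactusCore_singleton⟩
  by_cases hb : ∃ S₁ S₂ a b, IsBridge G S S₁ S₂ u a b v
  · obtain ⟨S₁, S₂, a, b, hb⟩ := hb
    rcases (hb.mem_iff x).1 hx with hx | hx
    · exact exists_core_of_bridge ihm hS hb hd hp hn hq hm hx
    · obtain ⟨F, hF⟩ := exists_core_of_bridge ihm hS.symm hb.symm hd.symm hp hn (q := q.reverse)
        (by simpa using hq) (by simpa using hm) hx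
      exact ⟨F, hF.symm⟩
  simp only [not_exists] at hb
  have hcut := noCut_of_noBridge hsc hS hb
  obtain ⟨a, ha, b, hb, hab, hua, hub⟩ := exists_two_adj_start hS huv hb
  obtain ⟨P₀, Q₀, h₀⟩ := exists_pathPair hcut hS.left_mem ha hb hab hua hub (Ne.symm huv)
    q.reverse (by simpa using hq)
  obtain ⟨P, Q, h, hxC | ⟨hxC, k, y, l, z, hyP, hyQ, -, -, hky, -, hk, hl, hexit⟩⟩ :=
    exists_pathPair_two_exits hsc hcut hx huv h₀ (hS.joined x hx).symm
  · refine ⟨PathPair.cycle P Q, h.isCycleSub.1, fun t ht => ?_, hxC, h.isCycleSub.cactusSub,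
      h.isTip_left, h.isTip_right, fun w hw hwF => ⟨_, le_rfl, h.isCycleSub, fun _ _ _ hy _ => hy⟩⟩
    rcases PathPair.mem_cycle.1 ht with ht | ht
    exacts [h.left_mem t ht, h.right_mem t ht]
  · set C := PathPair.cycle P Q
    set K := {t | Joined G (S \ C.verts) x t}
    have hKexit : ∀ k' ∈ K, ∀ t ∈ S, t ∉ K → G.Adj k' t → k' = k ∨ k' = l := by
      intro k' hk' t ht htK hkt
      refine hexit k' hk' t ?_ hkt
      by_contra htC
      exact htK (hk'.trans (.of_adj hkt hk'.right_mem ⟨ht, htC⟩))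
    have hu : u ∉ K := fun h' => h'.right_mem.2 (PathPair.mem_cycle.2 (.inl P.start_mem_support))
    have hv : v ∉ K := fun h' => h'.right_mem.2 (PathPair.mem_cycle.2 (.inl P.end_mem_support))
    have hdK : d ∉ K := by
      rcases hd with rfl | rfl
      exacts [hu, hv]
    have hxK : x ∈ K := Joined.refl hk.left_mem
    have hkl : Joined G K k l := by
      refine ((hk.symm.trans hl).inter_of_closed (T := K) hk fun s hs t ht hst => ?_).mono
        Set.inter_subset_right
      exact hs.trans (.of_adj hst hs.right_mem ht)
    have hK : Linked G K k l := hS.of_exits (fun t ht => ht.right_mem.1) hk hl hkl hKexit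
      (fun h' => absurd h' hu) fun h' => absurd h' hv
    obtain ⟨e, r, he, hr, -, hrl⟩ := Linked.exists_walk_of_exits hKexit subset_rfl hxK
      (fun h' => absurd h' hdK) p hp
    obtain ⟨q', hq'⟩ := hkl
    obtain ⟨F₂, h₂⟩ := ihn r.length ((hrl hdK).trans_le hn) q'.length K k l x hK
      ⟨e, r, he, fun t ht => (hr t ht).1, le_rfl⟩ ⟨q', hq', le_rfl⟩
    exact exists_core_of_cycle h hyP hyQ hky hexit h₂

/-- If every vertex of `G[S]` remains joined to `u` or to `v` after removing another vertex, then
`G[S]` has a cactus core containing any given vertex. -/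
lemma Linked.exists_isCactusCore {G : SimpleGraph V} (hsc : Subcubic G) {S : Set V} {u v x : V}
    (h : Linked G S u v) (hx : x ∈ S) : ∃ F : G.Subgraph, IsCactusCore G S u v x F := by
  obtain ⟨p, hp⟩ := h.joined x hx
  obtain ⟨q, hq⟩ := (h.joined v h.right_mem).symm
  exact hasCores hsc p.length q.length S u v x h ⟨u, p, .inl rfl, hp, le_rfl⟩ ⟨q, hq, le_rfl⟩

lemma reachable_del_iff {G : SimpleGraph V} {S : Set V} {a b : V} (ha : a ∉ S) :
    (del G S).Reachable a b ↔ Joined G Sᶜ a b := by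
  constructor
  · rintro ⟨p⟩
    induction p with
    | nil => exact .refl ha
    | cons e p ih => exact (Joined.of_adj e.1 e.2.1 e.2.2).trans (ih e.2.2)
  · rintro ⟨p, hp⟩
    induction p with
    | nil => exact .rfl
    | cons e p ih =>
      have hb := hp _ (List.mem_cons_of_mem _ p.start_mem_support)
      exact (Adj.reachable (G := del G S) ⟨e, ha, hb⟩).trans
        (ih hb fun y hy => hp y (List.mem_cons_of_mem _ hy))

lemma joined_univ_iff {G : SimpleGraph V} {a b : V} : Joined G Set.univ a b ↔ G.Reachable a b :=
  ⟨fun ⟨p, _⟩ => ⟨p⟩, fun ⟨p⟩ => ⟨p, by simp⟩⟩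

lemma joined_induce_iff {G : SimpleGraph V} {B : Set V} {T : Set B} {a b : B} :
    Joined (G.induce B) T a b ↔ Joined G (Subtype.val '' T) a b := by
  constructor
  · rintro ⟨p, hp⟩
    induction p with
    | nil => exact .refl ⟨_, hp _ (by simp), rfl⟩
    | cons e p ih =>
      exact (Joined.of_adj (S := Subtype.val '' T) (induce_adj.1 e) ⟨_, hp _ (by simp), rfl⟩
        ⟨_, hp _ (by simp), rfl⟩).trans
        (ih fun y hy => hp y (by simp [hy]))
  · intro h
    obtain ⟨a', ha', e⟩ := h.left_mem
    obtain rfl := Subtype.ext e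
    obtain ⟨b', hb, e⟩ := h.mem_of_closed
      (T := Subtype.val '' {b | Joined (G.induce B) T a' b}) ⟨a', .refl ha', rfl⟩ (by
        rintro _ ⟨y, hy, rfl⟩ _ ⟨z, hz, rfl⟩ hyz
        exact ⟨z, Joined.trans hy (.of_adj hyz (Joined.right_mem hy) hz), rfl⟩)
    exact Subtype.ext e ▸ hb

/-- The set `B` induces a non-separable graph. -/
structure NonsepSet (G : SimpleGraph V) (B : Set V) : Prop where
  nonempty : B.Nonempty
  joined : ∀ a ∈ B, ∀ b ∈ B, Joined G B a b
  noCut : NoCut G B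

lemma nonseparable_iff {G : SimpleGraph V} :
    Nonseparable G ↔ NonsepSet G Set.univ := by
  constructor
  · rintro ⟨hc, hs⟩
    have hj : ∀ a b, Joined G Set.univ a b := fun a b => joined_univ_iff.2 (hc.preconnected a b)
    refine ⟨⟨hc.nonempty.some, trivial⟩, fun a _ b _ => hj a b, fun c a _ b _ hac hbc => ?_⟩
    by_contra h
    refine hs c ⟨a, b, hac, hbc, hc.preconnected a b, fun h' => h ?_⟩
    rw [← Set.compl_eq_univ_sdiff]
    exact (reachable_del_iff (by simpa using hac)).1 h'
  · rintro ⟨⟨a, -⟩, hj, hs⟩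
    refine ⟨(connected_iff _).2 ⟨fun a b => joined_univ_iff.1 (hj a trivial b trivial), ⟨a⟩⟩, ?_⟩
    rintro c ⟨a, b, hac, hbc, -, h⟩
    refine h ((reachable_del_iff (by simpa using hac)).2 ?_)
    rw [Set.compl_eq_univ_sdiff]
    exact hs c a trivial b trivial hac hbc

lemma nonseparable_induce_iff {G : SimpleGraph V} {B : Set V} :
    Nonseparable (G.induce B) ↔ NonsepSet G B := by
  rw [nonseparable_iff]
  have hdel : ∀ c : B, Subtype.val '' (Set.univ \ {c}) = B \ {↑c} := fun c => by
    rw [Set.image_sdiff Subtype.val_injective]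
    simp
  constructor
  · rintro ⟨⟨a, -⟩, hj, hs⟩
    have hj' : ∀ a ∈ B, ∀ b ∈ B, Joined G B a b := fun a ha b hb => by
      simpa [joined_induce_iff] using hj ⟨a, ha⟩ trivial ⟨b, hb⟩ trivial
    refine ⟨⟨a, a.2⟩, hj', fun c a ha b hb hac hbc => ?_⟩
    by_cases hc : c ∈ B
    · have := hs ⟨c, hc⟩ ⟨a, ha⟩ trivial ⟨b, hb⟩ trivial (by simpa using hac) (by simpa using hbc)
      rwa [joined_induce_iff, hdel] at this
    · rw [Set.sdiff_singleton_eq_self hc]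
      exact hj' a ha b hb
  · rintro ⟨⟨a, ha⟩, hj, hs⟩
    refine ⟨⟨⟨a, ha⟩, trivial⟩, fun a _ b _ => ?_, fun c a _ b _ hac hbc => ?_⟩
    · simpa [joined_induce_iff] using hj a a.2 b b.2
    · rw [joined_induce_iff, hdel]
      exact hs c a a.2 b b.2 (by simpa [Subtype.ext_iff] using hac)
        (by simpa [Subtype.ext_iff] using hbc)

lemma isBlockSet_iff {G : SimpleGraph V} {B : Set V} :
    IsBlockSet G B ↔ NonsepSet G B ∧ ∀ B', B ⊆ B' → NonsepSet G B' → B' = B := by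
  simp only [IsBlockSet, nonseparable_induce_iff]

lemma isCutVert_of_not_joined {G : SimpleGraph V} (hG : G.Connected) {c a b : V} (ha : a ≠ c)
    (hb : b ≠ c) (h : ¬ Joined G {c}ᶜ a b) : IsCutVert G c :=
  ⟨a, b, ha, hb, hG.preconnected a b, fun h' => h ((reachable_del_iff (by simpa using ha)).1 h')⟩

lemma joined_of_not_isCutVert {G : SimpleGraph V} (hG : G.Connected) {c a b : V}
    (hc : ¬ IsCutVert G c) (ha : a ≠ c) (hb : b ≠ c) : Joined G {c}ᶜ a b := by
  by_contra h
  exact hc (isCutVert_of_not_joined hG ha hb h)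

namespace NonsepSet

variable {G : SimpleGraph V} {B B' : Set V}

lemma union (h : NonsepSet G B) (h' : NonsepSet G B') {s t : V} (hst : s ≠ t) (hs : s ∈ B)
    (hs' : s ∈ B') (ht : t ∈ B) (ht' : t ∈ B') : NonsepSet G (B ∪ B') := by
  refine ⟨⟨s, .inl hs⟩, ?_, fun c => ?_⟩
  · have key : ∀ a ∈ B ∪ B', Joined G (B ∪ B') a s := by
      rintro a (ha | ha)
      exacts [(h.joined a ha s hs).mono Set.subset_union_left,
        (h'.joined a ha s hs').mono Set.subset_union_right]
    exact fun a ha b hb => (key a ha).trans (key b hb).symm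
  · obtain ⟨r, hrc, hr, hr'⟩ : ∃ r, r ≠ c ∧ r ∈ B ∧ r ∈ B' := by
      by_cases hsc : s = c
      exacts [⟨t, fun e => hst (hsc.trans e.symm), ht, ht'⟩, ⟨s, hsc, hs, hs'⟩]
    have key : ∀ a ∈ B ∪ B', a ≠ c → Joined G ((B ∪ B') \ {c}) a r := by
      rintro a (ha | ha) hac
      exacts [(h.noCut c a ha r hr hac hrc).mono
          (Set.sdiff_subset_sdiff_left Set.subset_union_left),
        (h'.noCut c a ha r hr' hac hrc).mono (Set.sdiff_subset_sdiff_left Set.subset_union_right)]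
    exact fun a ha b hb hac hbc => (key a ha hac).trans (key b hb hbc).symm

lemma pair {a b : V} (h : G.Adj a b) : NonsepSet G {a, b} := by
  have hj : Joined G {a, b} a b := .of_adj h (by simp) (by simp)
  refine ⟨⟨a, by simp⟩, ?_, ?_⟩
  · rintro s (rfl | rfl) t (rfl | rfl)
    exacts [.refl (by simp), hj, hj.symm, .refl (by simp)]
  · rintro c s (rfl | rfl) t (rfl | rfl) hs ht
    · exact .refl ⟨by simp, hs⟩
    · exact .of_adj h ⟨by simp, hs⟩ ⟨by simp, ht⟩
    · exact .of_adj h.symm ⟨by simp, hs⟩ ⟨by simp, ht⟩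
    · exact .refl ⟨by simp, hs⟩

lemma exists_isBlockSet (h : NonsepSet G B) : ∃ D, B ⊆ D ∧ IsBlockSet G D := by
  obtain ⟨D, hBD, hD⟩ := zorn_subset_nonempty {D | NonsepSet G D} (fun c hc hchain hne => by
    have hpair : ∀ a ∈ ⋃₀ c, ∀ b ∈ ⋃₀ c, ∃ D ∈ c, a ∈ D ∧ b ∈ D := by
      rintro a ⟨D, hD, ha⟩ b ⟨D', hD', hb⟩
      rcases hchain.total hD hD' with h | h
      exacts [⟨D', hD', h ha, hb⟩, ⟨D, hD, ha, h hb⟩]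
    refine ⟨⋃₀ c, ⟨?_, fun a ha b hb => ?_, fun d a ha b hb had hbd => ?_⟩,
      fun D hD => Set.subset_sUnion_of_mem hD⟩
    · obtain ⟨D, hD⟩ := hne
      exact (hc hD).nonempty.mono (Set.subset_sUnion_of_mem hD)
    · obtain ⟨D, hD, ha, hb⟩ := hpair a ha b hb
      exact ((hc hD).joined a ha b hb).mono (Set.subset_sUnion_of_mem hD)
    · obtain ⟨D, hD, ha, hb⟩ := hpair a ha b hb
      exact ((hc hD).noCut d a ha b hb had hbd).mono
        (Set.sdiff_subset_sdiff_left (Set.subset_sUnion_of_mem hD))) B h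
  exact ⟨D, hBD, isBlockSet_iff.2 ⟨hD.prop, fun B' hDB' hB' => (hD.eq_of_subset hB' hDB').symm⟩⟩

lemma exists_joined_ear {y z k l : V} (hy : y ∈ B) (hz : z ∈ B) (hyz : y ≠ z)
    (hyk : G.Adj y k) (hlz : G.Adj l z) {R : G.Walk k l} (hR : R.IsPath)
    (hRB : ∀ t ∈ R.support, t ∉ B) {c t : V}
    (ht : t ∈ R.support) (htc : t ≠ c) :
    ∃ s ∈ B, s ≠ c ∧ Joined G ((B ∪ {t | t ∈ R.support}) \ {c}) t s := by
  have hends : ∀ {s s' : V}, s ∈ B → s ≠ c → s' ∈ R.support → s' ≠ c → G.Adj s' s →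
      Joined G ((B ∪ {t | t ∈ R.support}) \ {c}) s' s := fun hs hsc hs' hsc' h =>
    .of_adj h ⟨.inr hs', hsc'⟩ ⟨.inl hs, hsc⟩
  obtain ⟨A, D, rfl⟩ := R.mem_support_iff_exists_append.1 ht
  have hA : c ∉ A.support → y ≠ c →
      Joined G ((B ∪ {s | s ∈ (A.append D).support}) \ {c}) t y := by
    intro hc hyc
    have h₁ : Joined G ((B ∪ {s | s ∈ (A.append D).support}) \ {c}) k t :=
      ⟨A, fun s hs => ⟨.inr (by simp [hs]), fun e => hc ((show s = c from e) ▸ hs)⟩⟩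
    exact h₁.symm.trans (hends hy hyc (by simp) h₁.left_mem.2 hyk.symm)
  have hD : c ∉ D.support → z ≠ c →
      Joined G ((B ∪ {s | s ∈ (A.append D).support}) \ {c}) t z := by
    intro hc hzc
    have h₁ : Joined G ((B ∪ {s | s ∈ (A.append D).support}) \ {c}) t l :=
      ⟨D, fun s hs => ⟨.inr (by simp [hs]), fun e => hc ((show s = c from e) ▸ hs)⟩⟩
    exact h₁.trans (hends hz hzc (by simp) h₁.right_mem.2 hlz)
  by_cases hc : c ∈ B
  · have hcR : c ∉ (A.append D).support := fun h => hRB c h hc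
    simp only [Walk.mem_support_append_iff, not_or] at hcR
    by_cases hyc : y = c
    · have hzc : z ≠ c := fun e => hyz (hyc.trans e.symm)
      exact ⟨z, hz, hzc, hD hcR.2 hzc⟩
    · exact ⟨y, hy, hyc, hA hcR.1 hyc⟩
  · have hyc : y ≠ c := fun e => hc (e ▸ hy)
    have hzc : z ≠ c := fun e => hc (e ▸ hz)
    by_cases hcA : c ∈ A.support
    · exact ⟨z, hz, hzc, hD (fun h => htc ((isPath_append_iff.1 hR).2.2 c hcA h).symm) hzc⟩
    · exact ⟨y, hy, hyc, hA hcA hyc⟩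

/-- Adding an ear to a non-separable graph keeps it non-separable. -/
lemma union_ear (h : NonsepSet G B) {y z k l : V} (hy : y ∈ B) (hz : z ∈ B) (hyz : y ≠ z)
    (hyk : G.Adj y k) (hlz : G.Adj l z) {R : G.Walk k l} (hR : R.IsPath)
    (hRB : ∀ t ∈ R.support, t ∉ B) :
    NonsepSet G (B ∪ {t | t ∈ R.support}) := by
  set T := B ∪ {t | t ∈ R.support}
  have hc : NoCut G T := by
    intro c
    have key : ∀ t ∈ T, t ≠ c → ∃ s ∈ B, s ≠ c ∧ Joined G (T \ {c}) t s := by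
      rintro t (ht | ht) htc
      exacts [⟨t, ht, htc, .refl ⟨.inl ht, htc⟩⟩, exists_joined_ear hy hz hyz hyk hlz hR hRB ht htc]
    intro a ha b hb hac hbc
    obtain ⟨s, hs, hsc, has⟩ := key a ha hac
    obtain ⟨t, ht, htc, hbt⟩ := key b hb hbc
    exact has.trans (((h.noCut c s hs t ht hsc htc).mono
      (Set.sdiff_subset_sdiff_left Set.subset_union_left)).trans hbt.symm)
  have key : ∀ t ∈ T, Joined G T t y := by
    rintro t (ht | ht)
    · exact (h.joined t ht y hy).mono Set.subset_union_left
    · exact (joined_of_mem_support (S := T) (fun s hs => .inr hs) ht R.start_mem_support).trans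
        (.of_adj hyk.symm (.inr R.start_mem_support) (.inl hy))
  exact ⟨⟨y, .inl hy⟩, fun a ha b hb => (key a ha).trans (key b hb).symm, hc⟩

end NonsepSet

section Blocks

variable {G : SimpleGraph V} {B B' : Set V}

lemma IsBlockSet.eq_of_mem (h : IsBlockSet G B) (h' : IsBlockSet G B') {s t : V} (hst : s ≠ t)
    (hs : s ∈ B) (hs' : s ∈ B') (ht : t ∈ B) (ht' : t ∈ B') : B = B' := by
  rw [isBlockSet_iff] at h h'
  have hu := h.1.union h'.1 hst hs hs' ht ht'
  exact (h.2 _ Set.subset_union_left hu).symm.trans (h'.2 _ Set.subset_union_right hu)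

/-- A vertex of a block separates its neighbors outside the block from the rest of the block. -/
lemma IsBlockSet.not_joined (h : IsBlockSet G B) {y k y' : V} (hy : y ∈ B) (hk : k ∉ B)
    (hyk : G.Adj y k) (hy' : y' ∈ B) : ¬ Joined G {y}ᶜ k y' := by
  intro hj
  obtain ⟨l, z, hl, hlz, hz, hzy⟩ := hj.exists_first_entry hk hy'
  obtain ⟨R, hR, hRB⟩ := hl.exists_isPath
  rw [isBlockSet_iff] at h
  have := h.2 _ Set.subset_union_left (h.1.union_ear hy hz (Ne.symm hzy) hyk hlz hR
    fun t ht => (hRB t ht).2)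
  rw [← this] at hk
  exact hk (.inr R.start_mem_support)

lemma exists_isBlockSet_of_adj {a b : V} (h : G.Adj a b) : ∃ D, a ∈ D ∧ b ∈ D ∧ IsBlockSet G D := by
  obtain ⟨D, hD, hb⟩ := (NonsepSet.pair h).exists_isBlockSet
  exact ⟨D, hD (by simp), hD (by simp), hb⟩

/-- A vertex which is not a cut-vertex lies in only one block. -/
lemma IsBlockSet.eq_of_not_isCutVert (hG : G.Connected) (h : IsBlockSet G B)
    (h' : IsBlockSet G B') {s t : V} (hst : s ≠ t) (hs : ¬ IsCutVert G s) (hsB : s ∈ B)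
    (hsB' : s ∈ B') : B = B' := by
  obtain ⟨k, z, -, hkz, hz, -⟩ := (joined_univ_iff.2 (hG.preconnected t s)).exists_first_entry
    (T := {s}) (by simpa using hst.symm) rfl
  obtain rfl : z = s := hz
  obtain ⟨D, hkD, hzD, hD⟩ := exists_isBlockSet_of_adj hkz
  have key : ∀ {B}, IsBlockSet G B → z ∈ B → k ∈ B := by
    intro B hB hzB
    obtain ⟨y, hy, hyz⟩ : ∃ y ∈ B, y ≠ z := by
      by_contra! hB'
      rw [isBlockSet_iff] at hB hD
      have : D = B := hB.2 D (fun y hy => hB' y hy ▸ hzD) hD.1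
      exact hkz.ne (hB' k (this ▸ hkD))
    by_contra hk
    exact hB.not_joined hzB hk hkz.symm hy (joined_of_not_isCutVert hG hs hkz.ne hyz)
  exact h.eq_of_mem h' hkz.ne (key h hsB) (key h' hsB') hsB hsB'

lemma eq_or_eq_of_encard_le_two {α : Type*} {s : Set α} (hs : s.encard ≤ 2) {a b c : α}
    (ha : a ∈ s) (hb : b ∈ s) (hc : c ∈ s) (hab : a ≠ b) : c = a ∨ c = b := by
  by_contra! h
  have h₁ : ({c, a, b} : Set α) ⊆ s := by
    rintro t (rfl | rfl | rfl) <;> assumption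
  have h₂ := (Set.encard_le_encard h₁).trans hs
  rw [Set.encard_insert_of_notMem (by simp [h]), Set.encard_pair hab] at h₂
  exact absurd h₂ (by decide)

lemma exists_entry_cutVert (hG : G.Connected) (h : IsBlockSet G B) {c t : V} (hc : c ∈ B)
    (ht : t ∉ B) (hcl : ∀ k, Joined G {c}ᶜ t k → G.Adj k c → k ∈ B) :
    ∃ z ∈ B, z ≠ c ∧ IsCutVert G z ∧ ∀ y ∈ B, ¬ Joined G {z}ᶜ t y := by
  obtain ⟨k, z, hk, hkz, hz, -⟩ :=
    (joined_univ_iff.2 (hG.preconnected t c)).exists_first_entry ht hc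
  have hkB : k ∉ B := hk.right_mem.2
  have hzk : Joined G {z}ᶜ t k := hk.mono fun y hy e => hy.2 ((show y = z from e) ▸ hz)
  have hsep : ∀ y ∈ B, ¬ Joined G {z}ᶜ t y := fun y hy h' =>
    h.not_joined hz hkB hkz.symm hy (hzk.symm.trans h')
  have hzc : z ≠ c := by
    rintro rfl
    exact hkB (hcl k hzk hkz)
  exact ⟨z, hz, hzc, isCutVert_of_not_joined hG hzk.left_mem hzc.symm (hsep c hc), hsep⟩

/-- Every vertex of a block-chain connecting `u` and `v` remains joined to `u` or to `v` after
removing another vertex. -/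
lemma joined_of_endBlocks (hbc : IsBlockChain G) {u v : V} {B₁ B₂ : Set V}
    (h₁ : IsEndBlock G B₁) (h₂ : IsEndBlock G B₂) (hne : B₁ ≠ B₂) (hu : u ∈ B₁) (hv : v ∈ B₂)
    (huc : ¬ IsCutVert G u) (hvc : ¬ IsCutVert G v) (huv : u ≠ v) {c w : V} (hwc : w ≠ c)
    (p : G.Walk u c) : Joined G {c}ᶜ w u ∨ Joined G {c}ᶜ w v := by
  classical
  induction hn : p.length using Nat.strong_induction_on generalizing c w with
  | _ n ih =>
  by_contra! hbad
  obtain ⟨hG, hblock, hcut⟩ := hbc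
  have hcu : u ≠ c := by
    rintro rfl
    exact hbad.2 (joined_of_not_isCutVert hG huc hwc huv.symm)
  have hcv : v ≠ c := by
    rintro rfl
    exact hbad.1 (joined_of_not_isCutVert hG hvc hwc huv)
  have hcc : IsCutVert G c := isCutVert_of_not_joined hG hwc hcu hbad.1
  obtain ⟨k, z, r, hkc, hz, -, hr, hrl⟩ := exists_first_entry p (T := {c}) (by simpa using hcu)
    ⟨c, p.end_mem_support, rfl⟩
  obtain rfl : z = c := hz
  have huk : Joined G {z}ᶜ u k := ⟨r, fun y hy => (hr y hy).2⟩
  obtain ⟨B, hkB, hzB, hB⟩ := exists_isBlockSet_of_adj hkc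
  obtain ⟨w', z', hw', hwz, hz', -⟩ := (joined_univ_iff.2
    (hG.preconnected w z)).exists_first_entry (T := {z}) (by simpa using hwc) rfl
  obtain rfl : z' = z := hz'
  rw [← Set.compl_eq_univ_sdiff] at hw'
  obtain ⟨D, hwD, hzD, hD⟩ := exists_isBlockSet_of_adj hwz
  have hin : ∀ {E}, IsBlockSet G E → ∀ {s t}, s ∈ E → t ∈ E → s ≠ z' → t ≠ z' →
      Joined G {z'}ᶜ s t := fun {_} hE {s t} hs ht hsz htz =>
    ((isBlockSet_iff.1 hE).1.noCut z' s hs t ht hsz htz).mono fun y hy => hy.2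
  have hBD : B ≠ D := by
    rintro rfl
    exact hbad.1 (hw'.trans ((hin hB hwD hkB hwz.ne hkc.ne).trans huk.symm))
  have hcl : ∀ t, t = u ∨ t = v → ∀ k', Joined G {z'}ᶜ t k' → G.Adj k' z' → k' ∈ B := by
    intro t ht k' hk' hkz'
    obtain ⟨E, hkE, hzE, hE⟩ := exists_isBlockSet_of_adj hkz'
    rcases eq_or_eq_of_encard_le_two (hcut z' hcc) ⟨hB, hzB⟩ ⟨hD, hzD⟩ ⟨hE, hzE⟩ hBD with rfl | rfl
    · exact hkE
    · have := hw'.trans ((hin hE hwD hkE hwz.ne hkz'.ne).trans hk'.symm)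
      rcases ht with rfl | rfl
      exacts [absurd this hbad.1, absurd this hbad.2]
  have huB : u ∉ B := by
    intro huB
    obtain rfl := hB.eq_of_not_isCutVert hG h₁.1 huv huc huB hu
    have hvB : v ∉ B := fun hvB => hne (hB.eq_of_not_isCutVert hG h₂.1 huv.symm hvc hvB hv)
    obtain ⟨c', hc', hne', hcc', -⟩ := exists_entry_cutVert hG hB hzB hvB (hcl v (.inr rfl))
    exact hne' (Set.encard_le_one_iff.1 h₁.2 c' z' ⟨hc', hcc'⟩ ⟨hzB, hcc⟩)
  have hvB : v ∉ B := by
    intro hvB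
    obtain rfl := hB.eq_of_not_isCutVert hG h₂.1 huv.symm hvc hvB hv
    obtain ⟨c', hc', hne', hcc', -⟩ := exists_entry_cutVert hG hB hzB huB (hcl u (.inl rfl))
    exact hne' (Set.encard_le_one_iff.1 h₂.2 c' z' ⟨hc', hcc'⟩ ⟨hzB, hcc⟩)
  obtain ⟨c₁, hc₁, hne₁, hcc₁, hsep₁⟩ := exists_entry_cutVert hG hB hzB huB (hcl u (.inl rfl))
  obtain ⟨c₂, hc₂, hne₂, hcc₂, hsep₂⟩ := exists_entry_cutVert hG hB hzB hvB (hcl v (.inr rfl))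
  obtain rfl : c₂ = c₁ := (eq_or_eq_of_encard_le_two (hblock B hB) ⟨hzB, hcc⟩ ⟨hc₁, hcc₁⟩
    ⟨hc₂, hcc₂⟩ hne₁.symm).resolve_left hne₂
  have hmem : c₂ ∈ r.support := by
    by_contra hmem
    exact hsep₁ k hkB ⟨r, fun y hy e => hmem ((show y = c₂ from e) ▸ hy)⟩
  rcases ih (r.takeUntil c₂ hmem).length
    ((r.length_takeUntil_le_length hmem).trans_lt (hrl.trans_eq hn)) hne₁.symm _ rfl with h | h
  exacts [hsep₁ z' hzB h.symm, hsep₂ z' hzB h.symm]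

/-- A block-chain connecting `u` and `v` is linked to `u` and some vertex, which can be taken
to be `v` unless `u = v`. -/
lemma BlockChainConn.exists_linked {u v : V} (h : BlockChainConn G u v) :
    ∃ v', Linked G Set.univ u v' ∧ (v = v' ∨ v = u) := by
  obtain ⟨hbc, hns | ⟨⟨x, hx⟩, B₁, B₂, h₁, h₂, hne, hu, hv, huc, hvc⟩⟩ := h
  · rw [nonseparable_iff] at hns
    have key : ∀ v', u ≠ v' → Linked G Set.univ u v' := fun v' huv =>
      ⟨trivial, trivial, fun w hw => hns.joined w hw u trivial, fun c _ w hw hwc => by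
        by_cases huc : u = c
        · exact .inr (hns.noCut c w hw v' trivial hwc fun e => huv (huc.trans e.symm))
        · exact .inl (hns.noCut c w hw u trivial hwc huc)⟩
    by_cases huv : u = v
    · by_cases hv' : ∃ v', u ≠ v'
      · obtain ⟨v', hv'⟩ := hv'
        exact ⟨v', key v' hv', .inr huv.symm⟩
      · push Not at hv'
        exact ⟨u, ⟨trivial, trivial, fun w hw => hns.joined w hw u trivial,
          fun c _ w _ hwc => absurd ((hv' w).symm.trans (hv' c)) hwc⟩, .inr huv.symm⟩
    · exact ⟨v, key v huv, .inl rfl⟩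
  · have hG := hbc.1
    have huv : u ≠ v := by
      rintro rfl
      refine hne (h₁.1.eq_of_not_isCutVert hG h₂.1 (t := x) ?_ huc hu hv)
      rintro rfl
      exact huc hx
    refine ⟨v, ⟨trivial, trivial, fun w _ => joined_univ_iff.2 (hG.preconnected w u),
      fun c _ w _ hwc => ?_⟩, .inl rfl⟩
    rw [← Set.compl_eq_univ_sdiff]
    obtain ⟨p⟩ := hG.preconnected u c
    exact joined_of_endBlocks hbc h₁ h₂ hne hu hv huc hvc huv hwc p

end Blocks

lemma verts_coeSubgraph_eq {G : SimpleGraph V} {F : G.Subgraph} (C : F.coe.Subgraph) :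
    (Subgraph.coeSubgraph C).verts = Subtype.val '' C.verts := rfl

lemma neighborSet_coeSubgraph {G : SimpleGraph V} {F : G.Subgraph} (C : F.coe.Subgraph)
    (a : F.verts) : (Subgraph.coeSubgraph C).neighborSet a = Subtype.val '' C.neighborSet a := by
  ext z
  refine (Subgraph.coeSubgraph_adj C a z).trans ⟨?_, ?_⟩
  · rintro ⟨_, hz, h⟩
    exact ⟨⟨z, hz⟩, h, rfl⟩
  · rintro ⟨z, h, rfl⟩
    exact ⟨a.2, z.2, h⟩

lemma isCycleSub_coeSubgraph {G : SimpleGraph V} {F : G.Subgraph} {C : F.coe.Subgraph} :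
    IsCycleSub (Subgraph.coeSubgraph C) ↔ IsCycleSub C := by
  have hdeg : ∀ a : F.verts, ((Subgraph.coeSubgraph C).neighborSet a).ncard =
      (C.neighborSet a).ncard := fun a => by
    rw [neighborSet_coeSubgraph, Set.ncard_image_of_injective _ Subtype.val_injective]
  have hconn : (Subgraph.coeSubgraph C).Connected ↔ C.Connected := by
    refine ⟨fun h => ?_, fun h => h.coeSubgraph⟩
    rw [connected_iff_joined] at h ⊢
    refine ⟨by simpa [verts_coeSubgraph_eq] using h.1, fun a ha b hb => ?_⟩
    obtain ⟨b', hb', e⟩ := (h.2 a ⟨a, ha, rfl⟩ b ⟨b, hb, rfl⟩).mem_of_closed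
      (T := Subtype.val '' {b | Joined C.spanningCoe C.verts a b}) ⟨a, Joined.refl ha, rfl⟩ (by
        rintro _ ⟨y, hy, rfl⟩ z hz hyz
        obtain ⟨z, hz', rfl⟩ : z ∈ Subtype.val '' C.neighborSet y :=
          neighborSet_coeSubgraph C y ▸ hyz
        exact ⟨z, Joined.trans hy (.of_adj hz' (Joined.right_mem hy)
          (C.edge_vert (Subgraph.Adj.symm hz'))), rfl⟩)
    exact Subtype.ext e ▸ hb'
  unfold IsCycleSub
  rw [hconn, verts_coeSubgraph_eq, Set.finite_image_iff Subtype.val_injective.injOn,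
    Set.image_nonempty, Set.forall_mem_image]
  simp only [hdeg]

lemma CactusSub.isCactus {G : SimpleGraph V} (hsc : Subcubic G) {F : G.Subgraph}
    (h : CactusSub F) : IsCactus F.coe := by
  have hnb : ∀ a : F.verts, Subtype.val '' F.coe.neighborSet a = F.neighborSet a := fun a => by
    ext z
    constructor
    · rintro ⟨z, hz, rfl⟩
      exact hz
    · intro hz
      exact ⟨⟨z, F.edge_vert (Subgraph.Adj.symm hz)⟩, hz, rfl⟩
  have hcard : ∀ a : F.verts, (F.coe.neighborSet a).ncard = (F.neighborSet a).ncard := fun a => by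
    rw [← hnb, Set.ncard_image_of_injective _ Subtype.val_injective]
  refine ⟨h.connected.coe, fun a => ⟨?_, ?_⟩, fun C₁ C₂ h₁ h₂ hne => ?_, fun a ha => ?_⟩
  · rw [← Set.finite_image_iff Subtype.val_injective.injOn, hnb]
    exact (hsc a).1.subset (F.neighborSet_subset a)
  · rw [hcard]
    exact (Set.ncard_le_ncard (F.neighborSet_subset a) (hsc a).1).trans (hsc a).2
  · have := h.disjoint _ (Subgraph.coeSubgraph_le C₁) _ (Subgraph.coeSubgraph_le C₂)
      (isCycleSub_coeSubgraph.2 h₁) (isCycleSub_coeSubgraph.2 h₂)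
      ((Subgraph.coeSubgraph_injective F).ne hne)
    rw [verts_coeSubgraph_eq, verts_coeSubgraph_eq] at this
    exact (Set.disjoint_image_iff Subtype.val_injective).1 this
  · rw [hcard]
    refine h.degree a a.2 ?_
    rintro ⟨C, hCF, hC, haC⟩
    have e : Subgraph.coeSubgraph (Subgraph.restrict (G' := F) C) = C := by
      rw [Subgraph.coeSubgraph_restrict_eq, inf_eq_right.2 hCF]
    rw [← e] at hC haC
    obtain ⟨a', ha', e'⟩ := haC
    exact ha _ (isCycleSub_coeSubgraph.1 hC) (Subtype.ext e' ▸ ha')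

lemma IsTip.not_isCutVert {G : SimpleGraph V} {F : G.Subgraph} {u : V} (h : IsTip F u) :
    ¬ IsCutVert F.spanningCoe u := by
  rintro ⟨a, b, hau, hbu, hab, hsep⟩
  have hj := joined_univ_iff.2 hab
  by_cases ha : a ∈ F.verts
  · have hb : b ∈ F.verts := hj.mem_of_closed ha fun y _ z _ hyz => F.edge_vert hyz.symm
    exact hsep ((reachable_del_iff (by simpa using hau)).2
      ((h.joined a ha b hb hau hbu).mono fun y hy => hy.2))
  · have hb : b ∈ ({a} : Set V) := hj.mem_of_closed rfl fun y hy z _ hyz =>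
      absurd (F.edge_vert hyz) ((show y = a from hy) ▸ ha)
    rw [show b = a from hb] at hsep
    exact hsep .rfl

/-- If `G` is a subcubic block-chain connecting `u` and `v` and `x ∈ V(G)`,
then `G` has a finite cactus `F` with `u, v, x ∈ V(F)` such that `u, v` are d-vertices
of `F` and for every component `H` of `G − F`, `N_G(V(H))` is contained in the vertex
set of a single cycle of `F`. -/
theorem blockChain_cactus {V : Type u} (G : SimpleGraph V) (hsc : Subcubic G)
    (u v x : V) (hbc : BlockChainConn G u v) :
    ∃ F : G.Subgraph, F.verts.Finite ∧ u ∈ F.verts ∧ v ∈ F.verts ∧ x ∈ F.verts ∧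
      IsCactus F.coe ∧ ¬ IsCutVert F.spanningCoe u ∧ ¬ IsCutVert F.spanningCoe v ∧
      ∀ w, w ∉ F.verts →
        ∃ C : G.Subgraph, C ≤ F ∧ IsCycleSub C ∧
          NSet G (compOf G F.verts w) ⊆ C.verts := by
  obtain ⟨v', hlink, hv⟩ := hbc.exists_linked
  obtain ⟨F, hF⟩ := hlink.exists_isCactusCore hsc (Set.mem_univ x)
  have hFv : IsTip F v := by
    rcases hv with rfl | rfl
    exacts [hF.right, hF.left]
  refine ⟨F, hF.finite, hF.left.mem, hFv.mem, hF.mem, hF.cactusSub.isCactus hsc,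
    hF.left.not_isCutVert, hFv.not_isCutVert, fun w hw => ?_⟩
  obtain ⟨C, hCF, hC, hCa⟩ := hF.attach w trivial hw
  rw [← Set.compl_eq_univ_sdiff] at hCa
  refine ⟨C, hCF, hC, ?_⟩
  rintro y ⟨hy, k, hk, hky⟩
  have hk : Joined G F.vertsᶜ w k := (reachable_del_iff hw).1 hk
  refine hCa k y hk ?_ hky
  by_contra hyF
  exact hy ((reachable_del_iff hw).2 (hk.trans (.of_adj hky hk.right_mem hyF)))

end IGraph
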